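/- arXiv:1607.04873 — 8 statements merged into one kernel-verified Lean document; each statement's English description precedes it below -/
import Mathlib

section
/- Let K be a field, n ≥ 1, d ≥ 0, and let V, W ⊆ K[x_1,…,x_n] be finite-dimensional subspaces, each connected to 1, such that F_1 · V · W ⊇ F_d (where products of subspaces denote K-linear spans of pairwise products). Then there exists a uniform determinantal representation of p_{n,d} of size dim V + dim W − 1; in particular N*(n,d) ≤ dim V + dim W − 1. -/
open MvPolynomial

/-- Exponent vectors in `n` variables of total degree at most `d`. -/
def ExpLE (n d : ℕ) : Type := {α : Fin n →₀ ℕ // (α.sum fun _ e => e) ≤ d}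

noncomputable instance (n d : ℕ) : Fintype (ExpLE n d) := by
  have key : ∀ α : ExpLE n d, ∀ i, α.1 i < d + 1 := by
    intro α i
    refine Nat.lt_succ_of_le (le_trans ?_ α.2)
    by_cases h : α.1 i = 0
    · simp [h]
    · rw [Finsupp.sum]
      exact Finset.single_le_sum (f := fun j => α.1 j) (fun _ _ => Nat.zero_le _)
        (Finsupp.mem_support_iff.mpr h)
  exact Fintype.ofInjective (fun α : ExpLE n d => fun i => (⟨α.1 i, key α i⟩ : Fin (d+1)))
    (fun α β h => Subtype.ext (Finsupp.ext fun i => congrArg Fin.val (congrFun h i)))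

instance (n d : ℕ) : DecidableEq (ExpLE n d) := by
  unfold ExpLE; infer_instance

/-- The ring `R = K[x₁,…,xₙ,(c_α)_{|α|≤d}]`. -/
abbrev URing (K : Type*) [Field K] (n d : ℕ) := MvPolynomial (Fin n ⊕ ExpLE n d) K

/-- The generic polynomial `p_{n,d} = Σ_{|α|≤d} c_α x^α`. -/
noncomputable def genPoly (K : Type*) [Field K] (n d : ℕ) : URing K n d :=
  ∑ α : ExpLE n d, X (Sum.inr α) * ∏ i : Fin n, X (Sum.inl i) ^ (α.1 i)

/-- The monomials `1, xᵢ, c_α, c_α xᵢ`. -/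
def allowedMonomials (K : Type*) [Field K] (n d : ℕ) : Set (URing K n d) :=
  {1} ∪ (Set.range fun i : Fin n => (X (Sum.inl i) : URing K n d))
    ∪ (Set.range fun α : ExpLE n d => (X (Sum.inr α) : URing K n d))
    ∪ (Set.range fun p : ExpLE n d × Fin n =>
        (X (Sum.inr p.1) * X (Sum.inl p.2) : URing K n d))

/-- A uniform determinantal representation of `p_{n,d}` of size `N`. -/
def IsUDR (K : Type*) [Field K] (n d N : ℕ)
    (M : Matrix (Fin N) (Fin N) (URing K n d)) : Prop :=
  (∀ i j, M i j ∈ Submodule.span K (allowedMonomials K n d)) ∧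
    M.det = genPoly K n d

/-- `N*(n,d)`: the minimal size of a uniform determinantal representation. -/
noncomputable def Nstar (K : Type*) [Field K] (n d : ℕ) : ℕ :=
  sInf {N : ℕ | ∃ M : Matrix (Fin N) (Fin N) (URing K n d), IsUDR K n d N M}

/-- Setting all the `c_α` to zero: `M ↦ M₀` entrywise. -/
noncomputable def killC (K : Type*) [Field K] (n d : ℕ) :
    URing K n d →ₐ[K] MvPolynomial (Fin n) K :=
  aeval (Sum.elim X fun _ => 0)

/-- A subspace `V ⊆ K[x₁,…,xₙ]` is connected to 1. -/
def ConnectedToOne (K : Type*) [Field K] (n : ℕ)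
    (V : Submodule K (MvPolynomial (Fin n) K)) : Prop :=
  V ≠ ⊥ ∧ ∀ e : ℕ,
    V ⊓ restrictTotalDegree (Fin n) K (e + 1) ≤
      restrictTotalDegree (Fin n) K 1 * (V ⊓ restrictTotalDegree (Fin n) K e)

open Matrix in
/-- A bordered determinant: if `A` and `B` have determinant one, then `f` and `g` with `A f = u` and
`B g = v` can be eliminated, leaving a bilinear expression in `(1, f)` and `(1, g)`. -/
theorem det_fromBlocks_bordered {R ι κ : Type*} [CommRing R] [Fintype ι] [DecidableEq ι]
    [Fintype κ] [DecidableEq κ] (f u : ι → R) (g v : κ → R) (A : Matrix ι ι R) (B : Matrix κ κ R)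
    (hf : A *ᵥ f = u) (hg : B *ᵥ g = v) (hA : A.det = 1) (hB : B.det = 1)
    (a : R) (b : ι → R) (c : κ → R) (L : Matrix ι κ R) :
    (fromBlocks
      (fromBlocks (of fun _ _ : Unit => a) (replicateRow Unit (-u)) (replicateCol Unit b) Aᵀ)
      (fromRows (replicateRow Unit c) L)
      (fromCols (replicateCol Unit (-v)) 0) B).det =
      a + f ⬝ᵥ b + c ⬝ᵥ g + f ⬝ᵥ (L *ᵥ g) := by
  have hf' : f ᵥ* Aᵀ = u := by rw [vecMul_transpose, hf]
  set P : Matrix ((Unit ⊕ ι) ⊕ κ) ((Unit ⊕ ι) ⊕ κ) R :=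
    fromBlocks (fromBlocks 1 (replicateRow Unit f) 0 1) 0 0 1 with hP
  set Q : Matrix ((Unit ⊕ ι) ⊕ κ) ((Unit ⊕ ι) ⊕ κ) R :=
    fromBlocks 1 0 (fromCols (replicateCol Unit g) 0) 1 with hQ
  set M := fromBlocks
      (fromBlocks (of fun _ _ : Unit => a) (replicateRow Unit (-u)) (replicateCol Unit b) Aᵀ)
      (fromRows (replicateRow Unit c) L)
      (fromCols (replicateCol Unit (-v)) 0) B with hM
  have hPdet : P.det = 1 := by simp [hP]
  have hQdet : Q.det = 1 := by simp [hQ]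
  have key : P * M * Q = fromBlocks
      (fromBlocks (of fun _ _ : Unit => a + f ⬝ᵥ b + c ⬝ᵥ g + f ⬝ᵥ (L *ᵥ g)) 0
        (replicateCol Unit (b + L *ᵥ g)) Aᵀ)
      (fromRows (replicateRow Unit (c + f ᵥ* L)) L) 0 B := by
    have h1 : P * M = fromBlocks
      (fromBlocks (of fun _ _ : Unit => a + f ⬝ᵥ b) 0 (replicateCol Unit b) Aᵀ)
      (fromRows (replicateRow Unit (c + f ᵥ* L)) L)
      (fromCols (replicateCol Unit (-v)) 0) B := by
      subst hf'
      ext ((i | i) | i) ((j | j) | j) <;>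
        simp [hP, hM, Matrix.mul_apply, one_apply, dotProduct, vecMul]
    rw [h1]
    subst hg
    ext ((i | i) | i) ((j | j) | j)
    · have : (c + f ᵥ* L) ⬝ᵥ g = c ⬝ᵥ g + f ⬝ᵥ (L *ᵥ g) := by
        rw [add_dotProduct, dotProduct_mulVec]
      simp only [dotProduct, Pi.add_apply] at this
      simp [hQ, Matrix.mul_apply, one_apply, dotProduct, this, add_assoc]
    all_goals simp [hQ, Matrix.mul_apply, one_apply, dotProduct, mulVec]
  have hdet := congrArg det key
  rw [det_mul, det_mul, hPdet, hQdet, det_fromBlocks_zero₂₁, det_fromBlocks_zero₁₂] at hdet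
  simpa [hA, hB] using hdet

/-- An element of `S * span (range g)` is a combination of the `g i` with coefficients in `S`. -/
theorem Submodule.exists_sum_mul_of_mem_mul_span_range {K A ι : Type*} [CommSemiring K] [Semiring A]
    [Algebra K A] [Fintype ι] (S : Submodule K A) (g : ι → A) {x : A}
    (hx : x ∈ S * Submodule.span K (Set.range g)) :
    ∃ l : ι → A, (∀ i, l i ∈ S) ∧ x = ∑ i, l i * g i := by
  induction hx using Submodule.mul_induction_on' with
  | mem_mul_mem s hs y hy =>
    obtain ⟨c, rfl⟩ := (Submodule.mem_span_range_iff_exists_fun K).1 hy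
    exact ⟨fun i => c i • s, fun i => S.smul_mem _ hs, by simp [Finset.mul_sum]⟩
  | add x _ y _ hx hy =>
    obtain ⟨l, hl, rfl⟩ := hx
    obtain ⟨l', hl', rfl⟩ := hy
    exact ⟨l + l', fun i => S.add_mem (hl i) (hl' i), by simp [add_mul, Finset.sum_add_distrib]⟩

/-- `V` is spanned by `1` and a family solving a linear system of determinant one
with coefficients of degree at most one. -/
def HasUnimodularSystem (K : Type*) [Field K] (n : ℕ) (V : Submodule K (MvPolynomial (Fin n) K))
    (ι : Type) [Fintype ι] [DecidableEq ι] : Prop :=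
  ∃ (f u : ι → MvPolynomial (Fin n) K) (A : Matrix ι ι (MvPolynomial (Fin n) K)),
    (∀ i, u i ∈ restrictTotalDegree (Fin n) K 1) ∧
    (∀ i j, A i j ∈ restrictTotalDegree (Fin n) K 1) ∧
    A.mulVec f = u ∧ A.det = 1 ∧
    V ≤ Submodule.span K (Set.range fun o : Option ι => o.elim 1 f)

theorem HasUnimodularSystem.extend {K : Type*} [Field K] {n : ℕ}
    {V C : Submodule K (MvPolynomial (Fin n) K)} {ι : Type} [Fintype ι] [DecidableEq ι]
    [FiniteDimensional K C] (h : HasUnimodularSystem K n V ι)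
    (hC : C ≤ restrictTotalDegree (Fin n) K 1 * V) :
    HasUnimodularSystem K n (V ⊔ C) (ι ⊕ Fin (Module.finrank K C)) := by
  obtain ⟨f, u, A, hu, hA, hAf, hdet, hV⟩ := h
  set b := Module.finBasis K C
  have hb : ∀ j, ∃ l : Option ι → MvPolynomial (Fin n) K,
      (∀ o, l o ∈ restrictTotalDegree (Fin n) K 1) ∧
      (b j : MvPolynomial (Fin n) K) = ∑ o, l o * o.elim 1 f := fun j =>
    Submodule.exists_sum_mul_of_mem_mul_span_range _ _
      (mul_le_mul' le_rfl hV (hC (b j).2))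
  choose l hl hbl using hb
  have h1 : (1 : MvPolynomial (Fin n) K) ∈ restrictTotalDegree (Fin n) K 1 := by
    simp [mem_restrictTotalDegree]
  refine ⟨Sum.elim f fun j => b j, Sum.elim u fun j => l j none,
    Matrix.fromBlocks A 0 (Matrix.of fun j i => - l j (some i)) 1, ?_, ?_, ?_, ?_, ?_⟩
  · rintro (i | j)
    exacts [hu i, hl j none]
  · rintro (i | i) (j | j)
    · exact hA i j
    · exact Submodule.zero_mem _
    · exact Submodule.neg_mem _ (hl i _)
    · simp only [Matrix.fromBlocks_apply₂₂, Matrix.one_apply]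
      split_ifs
      exacts [h1, Submodule.zero_mem _]
  · rw [Matrix.fromBlocks_mulVec]
    congr 1
    · simpa using hAf
    · ext1 j
      simp [hbl, Matrix.mulVec, dotProduct]
  · simp [hdet]
  · refine sup_le (hV.trans (Submodule.span_mono ?_)) ?_
    · rintro _ ⟨o | i, rfl⟩
      exacts [⟨none, rfl⟩, ⟨some (Sum.inl i), rfl⟩]
    · intro x hx
      have hx' : (⟨x, hx⟩ : C) ∈ Submodule.span K (Set.range b) := by simp [b.span_eq]
      have := Submodule.mem_map_of_mem (f := C.subtype) hx'
      rw [Submodule.map_span, ← Set.range_comp] at this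
      refine Submodule.span_mono ?_ this
      rintro _ ⟨j, rfl⟩
      exact ⟨some (Sum.inr j), rfl⟩

theorem Submodule.exists_disjoint_sup_eq {K E : Type*} [Field K] [AddCommGroup E] [Module K E]
    {U V : Submodule K E} (h : U ≤ V) : ∃ C, Disjoint U C ∧ U ⊔ C = V := by
  obtain ⟨C, hC⟩ := U.exists_isCompl
  refine ⟨C ⊓ V, hC.disjoint.mono_right inf_le_left, ?_⟩
  rw [← sup_inf_assoc_of_le C h, hC.sup_eq_top, top_inf_eq]

theorem ConnectedToOne.inf_zero_eq_span_one {K : Type*} [Field K] {n : ℕ}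
    {V : Submodule K (MvPolynomial (Fin n) K)} (hV : ConnectedToOne K n V) :
    V ⊓ restrictTotalDegree (Fin n) K 0 = Submodule.span K {1} := by
  have hle : restrictTotalDegree (Fin n) K 0 ≤ Submodule.span K {1} := by
    intro p hp
    rw [mem_restrictTotalDegree, Nat.le_zero, totalDegree_eq_zero_iff_eq_C] at hp
    rw [hp, Submodule.mem_span_singleton]
    exact ⟨coeff 0 p, by rw [smul_eq_C_mul, mul_one]⟩
  have hne : V ⊓ restrictTotalDegree (Fin n) K 0 ≠ ⊥ := by
    intro h0
    have hbot : ∀ e, V ⊓ restrictTotalDegree (Fin n) K e = ⊥ := by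
      intro e
      induction e with
      | zero => exact h0
      | succ e ih =>
        have := hV.2 e
        rwa [ih, Submodule.mul_bot, le_bot_iff] at this
    refine hV.1 (eq_bot_iff.2 fun p hp => ?_)
    rw [← hbot p.totalDegree]
    exact ⟨hp, (mem_restrictTotalDegree _ _ _).2 le_rfl⟩
  obtain ⟨p, hp, hp0⟩ := Submodule.exists_mem_ne_zero_of_ne_bot hne
  refine le_antisymm (inf_le_right.trans hle) ?_
  obtain ⟨c, rfl⟩ := Submodule.mem_span_singleton.1 (hle hp.2)
  have hc : c ≠ 0 := by
    rintro rfl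
    simp at hp0
  rw [Submodule.span_le, Set.singleton_subset_iff]
  simpa [smul_smul, hc] using Submodule.smul_mem _ c⁻¹ hp

theorem ConnectedToOne.exists_hasUnimodularSystem_inf {K : Type*} [Field K] {n : ℕ}
    {V : Submodule K (MvPolynomial (Fin n) K)} [FiniteDimensional K V]
    (hV : ConnectedToOne K n V) (e : ℕ) :
    ∃ (ι : Type) (_ : Fintype ι) (_ : DecidableEq ι),
      Fintype.card ι + 1 = Module.finrank K ↥(V ⊓ restrictTotalDegree (Fin n) K e) ∧
      HasUnimodularSystem K n (V ⊓ restrictTotalDegree (Fin n) K e) ι := by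
  induction e with
  | zero =>
    rw [hV.inf_zero_eq_span_one]
    refine ⟨Empty, inferInstance, inferInstance, ?_, Empty.elim, Empty.elim, 1, by simp, by simp,
      Subsingleton.elim _ _, by simp, ?_⟩
    · rw [finrank_span_singleton one_ne_zero]
      simp
    · refine Submodule.span_mono ?_
      rintro _ rfl
      exact ⟨none, rfl⟩
  | succ e ih =>
    obtain ⟨ι, _, _, hcard, h⟩ := ih
    have hmono : V ⊓ restrictTotalDegree (Fin n) K e ≤
        V ⊓ restrictTotalDegree (Fin n) K (e + 1) := by
      refine inf_le_inf_left _ fun p hp => ?_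
      rw [mem_restrictTotalDegree] at hp ⊢
      omega
    obtain ⟨C, hdisj, hsup⟩ := Submodule.exists_disjoint_sup_eq hmono
    have hCle : C ≤ V ⊓ restrictTotalDegree (Fin n) K (e + 1) := hsup ▸ le_sup_right
    have : FiniteDimensional K C :=
      Submodule.finiteDimensional_of_le (hCle.trans inf_le_left)
    have hfin := Submodule.finrank_sup_add_finrank_inf_eq
      (V ⊓ restrictTotalDegree (Fin n) K e) C
    rw [hdisj.eq_bot, finrank_bot, hsup, add_zero] at hfin
    refine ⟨ι ⊕ Fin (Module.finrank K C), inferInstance, inferInstance, ?_, ?_⟩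
    · rw [hfin, ← hcard, Fintype.card_sum, Fintype.card_fin]
      omega
    · rw [← hsup]
      exact h.extend (hCle.trans (hV.2 e))

theorem ConnectedToOne.exists_hasUnimodularSystem {K : Type*} [Field K] {n : ℕ}
    {V : Submodule K (MvPolynomial (Fin n) K)} [FiniteDimensional K V]
    (hV : ConnectedToOne K n V) :
    ∃ (ι : Type) (_ : Fintype ι) (_ : DecidableEq ι),
      Fintype.card ι + 1 = Module.finrank K V ∧ HasUnimodularSystem K n V ι := by
  obtain ⟨s, hs⟩ : V.FG := Module.Finite.iff_fg.1 inferInstance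
  have hle : V ≤ restrictTotalDegree (Fin n) K (s.sup totalDegree) := by
    rw [← hs, Submodule.span_le]
    intro p hp
    exact (mem_restrictTotalDegree _ _ _).2 (Finset.le_sup (f := totalDegree) hp)
  have := hV.exists_hasUnimodularSystem_inf (s.sup totalDegree)
  rwa [inf_eq_left.2 hle] at this

theorem restrictTotalDegree_one_le_span (K : Type*) [Field K] (n : ℕ) :
    restrictTotalDegree (Fin n) K 1 ≤ Submodule.span K ({1} ∪ Set.range X) := by
  rw [restrictTotalDegree, restrictSupport_eq_span, Submodule.span_le]
  rintro _ ⟨m, hm, rfl⟩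
  refine Submodule.subset_span ?_
  simp only [Set.mem_ofPred_eq] at hm
  rcases Nat.le_one_iff_eq_zero_or_eq_one.1 hm with h | h
  · left
    have : m = 0 := by
      ext i
      by_contra hi
      exact hi ((Finset.sum_eq_zero_iff.1 h) i (Finsupp.mem_support_iff.2 hi))
    simp [this]
  · right
    obtain ⟨i, rfl⟩ := (Finsupp.sum_eq_one_iff m).1 h
    exact ⟨i, rfl⟩

theorem rename_inl_mem_span_allowedMonomials {K : Type*} [Field K] {n d : ℕ}
    {p : MvPolynomial (Fin n) K} (hp : p ∈ restrictTotalDegree (Fin n) K 1) :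
    (rename Sum.inl p : URing K n d) ∈ Submodule.span K (allowedMonomials K n d) := by
  replace hp := restrictTotalDegree_one_le_span K n hp
  induction hp using Submodule.span_induction with
  | mem x hx =>
    refine Submodule.subset_span ?_
    rcases hx with rfl | ⟨i, rfl⟩
    · simp [allowedMonomials]
    · exact Or.inl (Or.inl (Or.inr ⟨i, by simp⟩))
  | zero => simp
  | add x y _ _ hx hy => simpa using Submodule.add_mem _ hx hy
  | smul a x _ hx => simpa using Submodule.smul_mem _ a hx

theorem X_mul_rename_inl_mem_span_allowedMonomials {K : Type*} [Field K] {n d : ℕ}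
    (α : ExpLE n d) {p : MvPolynomial (Fin n) K} (hp : p ∈ restrictTotalDegree (Fin n) K 1) :
    (X (Sum.inr α) * rename Sum.inl p : URing K n d) ∈
      Submodule.span K (allowedMonomials K n d) := by
  replace hp := restrictTotalDegree_one_le_span K n hp
  induction hp using Submodule.span_induction with
  | mem x hx =>
    refine Submodule.subset_span ?_
    rcases hx with rfl | ⟨i, rfl⟩
    · exact Or.inl (Or.inr ⟨α, by simp⟩)
    · exact Or.inr ⟨(α, i), by simp⟩
  | zero => simp
  | add x y _ _ hx hy => simpa [mul_add] using Submodule.add_mem _ hx hy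
  | smul a x _ hx => simpa using Submodule.smul_mem _ a hx

open Matrix in
theorem exists_isUDR_of_hasUnimodularSystem {K : Type*} [Field K] {n d : ℕ}
    {V W : Submodule K (MvPolynomial (Fin n) K)} {ι κ : Type} [Fintype ι] [DecidableEq ι]
    [Fintype κ] [DecidableEq κ] (hV : HasUnimodularSystem K n V ι)
    (hW : HasUnimodularSystem K n W κ)
    (hVW : restrictTotalDegree (Fin n) K d ≤ restrictTotalDegree (Fin n) K 1 * V * W) {N : ℕ}
    (hN : Fintype.card ι + Fintype.card κ + 1 = N) :
    ∃ M : Matrix (Fin N) (Fin N) (URing K n d), IsUDR K n d N M := by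
  obtain ⟨f, u, A, hu, hA, hAf, hAdet, hV⟩ := hV
  obtain ⟨g, v, B, hv, hB, hBg, hBdet, hW⟩ := hW
  have hprod : V * W ≤ Submodule.span K (Set.range fun q : Option ι × Option κ =>
      (q.1.elim 1 f * q.2.elim 1 g : MvPolynomial (Fin n) K)) := by
    refine (mul_le_mul' hV hW).trans ?_
    rw [Submodule.span_mul_span]
    refine Submodule.span_mono ?_
    rintro _ ⟨_, ⟨i, rfl⟩, _, ⟨j, rfl⟩, rfl⟩
    exact ⟨(i, j), rfl⟩
  have hmono : ∀ α : ExpLE n d, ∃ l : Option ι × Option κ → MvPolynomial (Fin n) K,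
      (∀ q, l q ∈ restrictTotalDegree (Fin n) K 1) ∧
      monomial α.1 (1 : K) = ∑ q, l q * (q.1.elim 1 f * q.2.elim 1 g) := by
    intro α
    refine Submodule.exists_sum_mul_of_mem_mul_span_range _ _
      (mul_le_mul' le_rfl hprod ?_)
    rw [← mul_assoc]
    refine hVW ((mem_restrictTotalDegree _ _ _).2 ?_)
    rw [totalDegree_monomial _ one_ne_zero]
    exact α.2
  choose l hl hsum using hmono
  set φ : MvPolynomial (Fin n) K →ₐ[K] URing K n d := rename Sum.inl with hφ
  set L : Option ι → Option κ → URing K n d :=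
    fun i j => ∑ α, X (Sum.inr α) * φ (l α (i, j)) with hL
  have hLmem : ∀ i j, L i j ∈ Submodule.span K (allowedMonomials K n d) := fun i j =>
    Submodule.sum_mem _ fun α _ => X_mul_rename_inl_mem_span_allowedMonomials α (hl α _)
  have hφmem : ∀ {p}, p ∈ restrictTotalDegree (Fin n) K 1 →
      φ p ∈ Submodule.span K (allowedMonomials K n d) :=
    rename_inl_mem_span_allowedMonomials
  have hgen : genPoly K n d =
      ∑ i, ∑ j, L i j * (φ (i.elim 1 f) * φ (j.elim 1 g)) := by
    have : ∀ α : ExpLE n d, ∏ i : Fin n, (X (Sum.inl i) : URing K n d) ^ (α.1 i) =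
        ∑ i, ∑ j, φ (l α (i, j)) * (φ (i.elim 1 f) * φ (j.elim 1 g)) := by
      intro α
      have h := congrArg φ (hsum α)
      rw [monomial_eq, Finsupp.prod_fintype _ _ (by simp), Fintype.sum_prod_type] at h
      simpa [hφ] using h
    simp only [genPoly, this, hL, Finset.mul_sum, Finset.sum_mul]
    rw [Finset.sum_comm]
    refine Finset.sum_congr rfl fun i _ => ?_
    rw [Finset.sum_comm]
    exact Finset.sum_congr rfl fun j _ => Finset.sum_congr rfl fun α _ => (mul_assoc _ _ _).symm
  have hφmulVec : ∀ {σ : Type} [Fintype σ] (D : Matrix σ σ (MvPolynomial (Fin n) K))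
      (w z : σ → MvPolynomial (Fin n) K), D *ᵥ w = z → D.map φ *ᵥ (φ ∘ w) = φ ∘ z := by
    rintro σ _ D w _ rfl
    exact (funext fun i => RingHom.map_mulVec φ.toRingHom D w i).symm
  have hφdet : ∀ {σ : Type} [Fintype σ] [DecidableEq σ]
      (D : Matrix σ σ (MvPolynomial (Fin n) K)), D.det = 1 → (D.map φ).det = 1 := by
    intro σ _ _ D hD
    have := AlgHom.map_det φ D
    rw [hD, map_one] at this
    exact this.symm
  have hdet := det_fromBlocks_bordered (φ ∘ f) (φ ∘ u) (φ ∘ g) (φ ∘ v) (A.map φ) (B.map φ)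
    (hφmulVec A f u hAf) (hφmulVec B g v hBg) (hφdet A hAdet) (hφdet B hBdet)
    (L none none) (fun i => L (some i) none) (fun j => L none (some j))
    (of fun i j => L (some i) (some j))
  have e : (Unit ⊕ ι) ⊕ κ ≃ Fin N := Fintype.equivFinOfCardEq (by simp; omega)
  refine ⟨reindex e e _, fun i j => ?_, (det_reindex_self e _).trans (hdet.trans ?_)⟩
  · rw [reindex_apply, submatrix_apply]
    generalize e.symm i = i
    generalize e.symm j = j
    rcases i with (i | i) | i <;> rcases j with (j | j) | j
    · exact hLmem _ _
    · exact Submodule.neg_mem _ (hφmem (hu j))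
    · exact hLmem _ _
    · exact hLmem _ _
    · exact hφmem (hA j i)
    · exact hLmem _ _
    · exact Submodule.neg_mem _ (hφmem (hv i))
    · exact Submodule.zero_mem _
    · exact hφmem (hB i j)
  · rw [hgen]
    simp only [Fintype.sum_option, Option.elim, map_one, dotProduct, mulVec, Function.comp, of_apply,
      mul_one, one_mul, Finset.mul_sum, Finset.sum_add_distrib]
    have h₁ : ∀ i, φ (f i) * L (some i) none = L (some i) none * φ (f i) :=
      fun i => mul_comm _ _
    have h₂ : ∀ i j, φ (f i) * (L (some i) (some j) * φ (g j)) =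
        L (some i) (some j) * (φ (f i) * φ (g j)) := fun i j => mul_left_comm _ _ _
    simp only [h₁, h₂, add_assoc]

/-- Proposition 5.2. If `V, W ⊆ K[x₁,…,xₙ]` are finite-dimensional
subspaces connected to 1 with `F₁ · V · W ⊇ F_d`, then there is a uniform determinantal
representation of `p_{n,d}` of size `dim V + dim W − 1`; in particular
`N*(n,d) ≤ dim V + dim W − 1`. -/
theorem udr_second_construction (K : Type*) [Field K] (n d : ℕ)
    (V W : Submodule K (MvPolynomial (Fin n) K))
    [FiniteDimensional K V] [FiniteDimensional K W]
    (hV : ConnectedToOne K n V) (hW : ConnectedToOne K n W)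
    (hVW : restrictTotalDegree (Fin n) K d ≤
      restrictTotalDegree (Fin n) K 1 * V * W) :
    (∃ M : Matrix (Fin (Module.finrank K V + Module.finrank K W - 1))
        (Fin (Module.finrank K V + Module.finrank K W - 1)) (URing K n d),
      IsUDR K n d (Module.finrank K V + Module.finrank K W - 1) M) ∧
    Nstar K n d ≤ Module.finrank K V + Module.finrank K W - 1 := by
  obtain ⟨ι, _, _, hι, hιV⟩ := hV.exists_hasUnimodularSystem
  obtain ⟨κ, _, _, hκ, hκW⟩ := hW.exists_hasUnimodularSystem
  have h := exists_isUDR_of_hasUnimodularSystem hιV hκW hVW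
    (N := Module.finrank K V + Module.finrank K W - 1) (by omega)
  exact ⟨h, Nat.sInf_le h⟩
end

section
/- Let K be a field and n ≥ 1, d ≥ 1 integers. Then N*(n,d) ≤ binom(n + ⌈(d−1)/2⌉, n) + binom(n + ⌊(d−1)/2⌋, n) − 1; that is, taking V = F_{⌈(d−1)/2⌉} and W = F_{⌊(d−1)/2⌋} yields a uniform determinantal representation of p_{n,d} of that size. -/
open MvPolynomial

section BorderedMatrix

variable {R P Q : Type*} [CommRing R] [DecidableEq P] [DecidableEq Q]

/-- A matrix which is triangular for a weight function on its indices has determinant the product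
of its diagonal entries. -/
theorem det_eq_prod_diag_of_weight {ι : Type*} [Fintype ι] [DecidableEq ι] (M : Matrix ι ι R)
    (ρ : ι → ℤ) (h : ∀ i j, i ≠ j → ρ i ≤ ρ j → M i j = 0) : M.det = ∏ i, M i i := by
  rw [Matrix.det_apply, Finset.sum_eq_single 1]
  · simp
  · intro σ _ hσ
    suffices ∃ i, M (σ i) i = 0 by
      obtain ⟨i, hi⟩ := this
      have := Finset.prod_eq_zero (f := fun j => M (σ j) j) (Finset.mem_univ i) hi
      simp only [this, smul_zero]
    by_contra! hne
    have hle : ∀ i, σ i ≠ i → ρ i < ρ (σ i) := fun i hi => by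
      by_contra! hlt
      exact hne i (h _ _ hi hlt)
    obtain ⟨i, hi⟩ : ∃ i, σ i ≠ i := by
      by_contra! hall
      exact hσ (Equiv.ext hall)
    have hlt : ∑ i, ρ i < ∑ i, ρ (σ i) := by
      refine Finset.sum_lt_sum (fun j _ => ?_) ⟨i, Finset.mem_univ i, hle i hi⟩
      by_cases hj : σ j = j
      · rw [hj]
      · exact (hle j hj).le
    rw [Equiv.sum_comp σ ρ] at hlt
    exact lt_irrefl _ hlt
  · simp

/-- The row of `p` in the matrix of the relations `v p = x p * v (pr p)`. -/
def relationRow (pr : P → Option P) (x : P → R) (p : P) (o : Option P) : R :=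
  (if o = some p then 1 else 0) - (if o = pr p then x p else 0)

/-- The matrix `L` bordered on top by the relations `prA, xA` among its columns and on the right by
the transposed relations `prB, xB` among its rows. -/
def borderedMatrix (prA : P → Option P) (xA : P → R) (prB : Q → Option Q) (xB : Q → R)
    (L : Option Q → Option P → R) : Matrix (Option (P ⊕ Q)) (Option (P ⊕ Q)) R
  | some (.inl p), none => relationRow prA xA p none
  | some (.inl p), some (.inl p') => relationRow prA xA p (some p')
  | some (.inl _), some (.inr _) => 0
  | none, none => L none none
  | none, some (.inl p) => L none (some p)
  | none, some (.inr q) => relationRow prB xB q none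
  | some (.inr q), none => L (some q) none
  | some (.inr q), some (.inl p) => L (some q) (some p)
  | some (.inr q), some (.inr q') => relationRow prB xB q' (some q)

theorem sum_relationRow_mul [Fintype P] (pr : P → Option P) (x : P → R) (v : Option P → R)
    (hv : ∀ p, v (some p) = x p * v (pr p)) (p : P) :
    ∑ o, relationRow pr x p o * v o = 0 := by
  simp [relationRow, sub_mul, Finset.sum_sub_distrib, ite_mul, hv, -Fintype.sum_option]

theorem relationRow_self (pr : P → Option P) (x : P → R) (r : P → ℕ)
    (hr : ∀ p p', pr p = some p' → r p' < r p) (p : P) :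
    relationRow pr x p (some p) = 1 := by
  have : some p ≠ pr p := fun h => lt_irrefl _ (hr p p h.symm)
  simp [relationRow, this]

theorem relationRow_of_le (pr : P → Option P) (x : P → R) (r : P → ℕ)
    (hr : ∀ p p', pr p = some p' → r p' < r p) {p p' : P} (hne : p ≠ p') (hle : r p ≤ r p') :
    relationRow pr x p (some p') = 0 := by
  have : some p' ≠ pr p := fun h => (hr p p' h.symm).not_ge hle
  simp [relationRow, this, hne.symm]

theorem det_borderedMatrix [Fintype P] [Fintype Q] (prA : P → Option P) (xA : P → R)
    (prB : Q → Option Q) (xB : Q → R) (L : Option Q → Option P → R) (v : Option P → R) (w : Option Q → R)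
    (hv₀ : v none = 1) (hw₀ : w none = 1)
    (hv : ∀ p, v (some p) = xA p * v (prA p)) (hw : ∀ q, w (some q) = xB q * w (prB q))
    (rA : P → ℕ) (hA : ∀ p p', prA p = some p' → rA p' < rA p)
    (rB : Q → ℕ) (hB : ∀ q q', prB q = some q' → rB q' < rB q) :
    (borderedMatrix prA xA prB xB L).det = ∑ o, ∑ o', w o * L o o' * v o' := by
  set M := borderedMatrix prA xA prB xB L with hM
  let c : Option (P ⊕ Q) → R := fun o => o.elim 1 (Sum.elim (fun p => v (some p)) fun _ => 0)
  let r : Option (P ⊕ Q) → R := fun o => o.elim 1 (Sum.elim (fun _ => 0) fun q => w (some q))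
  set M₁ := M.updateCol none (fun k => ∑ i, c i • M k i) with hM₁
  set M₂ := M₁.updateRow none (∑ k, r k • M₁ k) with hM₂
  have h₁ : M₁.det = M.det := by
    rw [hM₁, Matrix.det_updateCol_sum]; simp [c]
  have h₂ : M₂.det = M₁.det := by
    rw [hM₂, Matrix.det_updateRow_sum]; simp [r]
  have colA : ∀ p, M₁ (some (.inl p)) none = 0 := fun p => by
    have := sum_relationRow_mul prA xA v hv p
    rw [Fintype.sum_option] at this
    simpa [hM₁, c, hM, borderedMatrix, Fintype.sum_option, mul_comm, hv₀] using this
  have rowB : ∀ q, M₂ none (some (.inr q)) = 0 := fun q => by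
    have := sum_relationRow_mul prB xB w hw q
    rw [Fintype.sum_option] at this
    simpa [hM₂, hM₁, r, hM, borderedMatrix, Fintype.sum_option, mul_comm, hw₀] using this
  have corner : M₂ none none = ∑ o, ∑ o', w o * L o o' * v o' := by
    simp [hM₂, hM₁, r, c, hM, borderedMatrix, Fintype.sum_option, hv₀, hw₀]
    simp only [mul_add, Finset.mul_sum, Finset.sum_add_distrib, mul_comm, mul_left_comm]
  let sA := ∑ p, rA p
  let sB := ∑ q, rB q
  have hsA : ∀ p, rA p ≤ sA := fun p => Finset.single_le_sum (fun _ _ => Nat.zero_le _)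
    (Finset.mem_univ p)
  have hsB : ∀ q, rB q ≤ sB := fun q => Finset.single_le_sum (fun _ _ => Nat.zero_le _)
    (Finset.mem_univ q)
  let ρ : Option (P ⊕ Q) → ℤ := fun o =>
    o.elim 0 (Sum.elim (fun p => rA p - (sA + 1)) fun q => sB + 1 - rB q)
  rw [← h₁, ← h₂, det_eq_prod_diag_of_weight M₂ ρ, Fintype.prod_option, corner]
  · simp [hM₂, hM₁, hM, borderedMatrix, relationRow_self prA xA rA hA,
      relationRow_self prB xB rB hB]
  · rintro (_ | p | q) (_ | p' | q') hne hle
    · exact absurd rfl hne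
    · have := hsA p'
      simp only [ρ, Option.elim, Sum.elim_inl] at hle
      omega
    · exact rowB q'
    · simpa [hM₂] using colA p
    · simp only [ρ, Option.elim, Sum.elim_inl] at hle
      simpa [hM₂, hM₁, hM, borderedMatrix] using
        relationRow_of_le prA xA rA hA (fun h => hne (by rw [h])) (by omega)
    · simp [hM₂, hM₁, hM, borderedMatrix]
    · have := hsB q
      simp only [ρ, Option.elim, Sum.elim_inr] at hle
      omega
    · have := hsB q
      have := hsA p'
      simp only [ρ, Option.elim, Sum.elim_inl, Sum.elim_inr] at hle
      omega
    · simp only [ρ, Option.elim, Sum.elim_inr] at hle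
      simpa [hM₂, hM₁, hM, borderedMatrix] using
        relationRow_of_le prB xB rB hB (fun h => hne (by rw [h])) (by omega)

end BorderedMatrix

section Exponents

theorem exists_eq_add_single {ι : Type*} (α : ι →₀ ℕ) (h : α ≠ 0) :
    ∃ (β : ι →₀ ℕ) (i : ι), α = β + Finsupp.single i 1 := by
  obtain ⟨i, hi⟩ := Finsupp.ne_iff.mp h
  refine ⟨α - Finsupp.single i 1, i, (tsub_add_cancel_of_le ?_).symm⟩
  simpa [Nat.one_le_iff_ne_zero] using hi

theorem exists_add_degree_le {ι : Type*} (k m : ℕ) (γ : ι →₀ ℕ) (h : γ.degree ≤ k + m) :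
    ∃ α β : ι →₀ ℕ, γ = α + β ∧ α.degree ≤ k ∧ β.degree ≤ m := by
  induction k generalizing γ with
  | zero => exact ⟨0, γ, by simp, by simp, by simpa using h⟩
  | succ k ih =>
    by_cases h₀ : γ = 0
    · exact ⟨0, 0, by simp [h₀], by simp, by simp⟩
    obtain ⟨β, i, rfl⟩ := exists_eq_add_single γ h₀
    rw [map_add, Finsupp.degree_single] at h
    obtain ⟨α', β', rfl, hα, hβ⟩ := ih β (by omega)
    exact ⟨α' + Finsupp.single i 1, β', by abel, by rw [map_add, Finsupp.degree_single]; omega, hβ⟩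

theorem card_ExpLE_le (n d : ℕ) : Fintype.card (ExpLE n d) ≤ (n + d).choose n := by
  classical
  have hcard : ∀ α : Fin n →₀ ℕ, Multiset.card (Finsupp.toMultiset α) = α.sum fun _ e => e :=
    fun α => Finsupp.card_toMultiset α
  let f : ExpLE n d → Sym (Option (Fin n)) d := fun α =>
    ⟨(Finsupp.toMultiset α.1).map some + Multiset.replicate (d - α.1.sum fun _ e => e) none, by
      have := α.2
      simp only [Multiset.card_add, Multiset.card_map, hcard, Multiset.card_replicate]
      omega⟩
  have hf : Function.Injective f := by
    intro α β h
    refine Subtype.ext (Finsupp.ext fun i => ?_)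
    have := congrArg (fun s => Multiset.count (some i) s.1) h
    simpa [f, Multiset.count_map_eq_count' _ _ (Option.some_injective _),
      Multiset.count_replicate] using this
  refine (Fintype.card_le_of_injective f hf).trans (le_of_eq ?_)
  rw [Sym.card_sym_eq_choose, Fintype.card_option, Fintype.card_fin,
    show n + 1 + d - 1 = n + d by omega, Nat.choose_symm_add]

/-- Nonzero exponent vectors of total degree at most `d`. -/
abbrev PosExp (n d : ℕ) : Type := {α : ExpLE n d // α.1 ≠ 0}

/-- Exponent vectors of total degree at most `d`, the zero vector being `none`. -/
def optExp {n d : ℕ} (o : Option (PosExp n d)) : Fin n →₀ ℕ := o.elim 0 fun α => α.1.1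

theorem exists_optExp_eq {n d : ℕ} (α : Fin n →₀ ℕ) (h : α.degree ≤ d) :
    ∃ o : Option (PosExp n d), optExp o = α := by
  by_cases h₀ : α = 0
  · exact ⟨none, h₀.symm⟩
  · exact ⟨some ⟨⟨α, h⟩, h₀⟩, rfl⟩

theorem exists_predecessor (n d : ℕ) : ∃ (pr : PosExp n d → Option (PosExp n d))
    (i : PosExp n d → Fin n), ∀ p, optExp (some p) = optExp (pr p) + Finsupp.single (i p) 1 := by
  have : ∀ p : PosExp n d, ∃ (o : Option (PosExp n d)) (i : Fin n),
      optExp (some p) = optExp o + Finsupp.single i 1 := by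
    intro p
    obtain ⟨β, i, h⟩ := exists_eq_add_single p.1.1 p.2
    have hd : p.1.1.degree ≤ d := p.1.2
    rw [h, map_add, Finsupp.degree_single] at hd
    obtain ⟨o, rfl⟩ := exists_optExp_eq (d := d) β (by omega)
    exact ⟨o, i, h⟩
  choose pr i h using this
  exact ⟨pr, i, h⟩

theorem card_option_PosExp_le (n d : ℕ) :
    Fintype.card (PosExp n d) + 1 ≤ (n + d).choose n := by
  refine le_trans ?_ (card_ExpLE_le n d)
  exact Fintype.card_subtype_lt (x := (⟨0, by simp⟩ : ExpLE n d)) (by simp)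

end Exponents

section Representation

variable (K : Type*) [Field K] (n d : ℕ)

/-- The monomial `x^α` in `R`. -/
noncomputable def xMonomial (α : Fin n →₀ ℕ) : URing K n d := ∏ i, X (Sum.inl i) ^ α i

theorem xMonomial_zero : xMonomial K n d 0 = 1 := by simp [xMonomial]

theorem xMonomial_add (α β : Fin n →₀ ℕ) :
    xMonomial K n d (α + β) = xMonomial K n d α * xMonomial K n d β := by
  simp [xMonomial, pow_add, Finset.prod_mul_distrib]

theorem xMonomial_single (i : Fin n) :
    xMonomial K n d (Finsupp.single i 1) = X (Sum.inl i) := by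
  rw [xMonomial, Finset.prod_eq_single i] <;> simp +contextual [eq_comm]

variable {K n d}

theorem relationRow_mem_span {P : Type*} [DecidableEq P] (pr : P → Option P) (i : P → Fin n)
    (p : P) (o : Option P) :
    relationRow pr (fun p => (X (Sum.inl (i p)) : URing K n d)) p o ∈
      Submodule.span K (allowedMonomials K n d) := by
  refine Submodule.sub_mem _ ?_ ?_ <;> split_ifs
  · exact Submodule.subset_span (by simp [allowedMonomials])
  · exact Submodule.zero_mem _
  · exact Submodule.subset_span (by simp [allowedMonomials])
  · exact Submodule.zero_mem _

theorem exists_split {a b : ℕ} (hab : a + b + 1 = d) (γ : ExpLE n d) :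
    ∃ (o : Option (PosExp n a)) (o' : Option (PosExp n b)) (δ : Fin n →₀ ℕ),
      γ.1 = optExp o + optExp o' + δ ∧
      X (Sum.inr γ) * xMonomial K n d δ ∈ allowedMonomials K n d := by
  obtain ⟨α, ε, hγ, hα, hε⟩ := exists_add_degree_le a (b + 1) γ.1
    (show γ.1.degree ≤ _ by rw [← add_assoc, hab]; exact γ.2)
  obtain ⟨β, δ, rfl, hβ, hδ⟩ := exists_add_degree_le b 1 ε hε
  obtain ⟨o, rfl⟩ := exists_optExp_eq α hα
  obtain ⟨o', rfl⟩ := exists_optExp_eq β hβ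
  refine ⟨o, o', δ, by rw [hγ, add_assoc], ?_⟩
  by_cases h₀ : δ = 0
  · simp [h₀, xMonomial_zero, allowedMonomials]
  · obtain ⟨δ', i, rfl⟩ := exists_eq_add_single δ h₀
    rw [map_add, Finsupp.degree_single] at hδ
    obtain rfl : δ' = 0 := by
      rw [← Finsupp.degree_eq_zero_iff]; omega
    rw [zero_add, xMonomial_single]
    exact Or.inr ⟨(γ, i), rfl⟩

theorem exists_isUDR {a b : ℕ} (hab : a + b + 1 = d) :
    ∃ M, IsUDR K n d (Fintype.card (Option (PosExp n a ⊕ PosExp n b))) M := by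
  obtain ⟨prA, iA, hA⟩ := exists_predecessor n a
  obtain ⟨prB, iB, hB⟩ := exists_predecessor n b
  choose oA oB δ hδ hmem using exists_split (K := K) (n := n) hab
  let L : Option (PosExp n b) → Option (PosExp n a) → URing K n d := fun o o' =>
    ∑ γ, if oB γ = o ∧ oA γ = o' then X (Sum.inr γ) * xMonomial K n d (δ γ) else 0
  have hL : ∀ o o', L o o' ∈ Submodule.span K (allowedMonomials K n d) := fun o o' => by
    refine Submodule.sum_mem _ fun γ _ => ?_
    split_ifs
    · exact Submodule.subset_span (hmem γ)
    · exact Submodule.zero_mem _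
  have hrank : ∀ (e : ℕ) (pr : PosExp n e → Option (PosExp n e)) (i : PosExp n e → Fin n),
      (∀ p, optExp (some p) = optExp (pr p) + Finsupp.single (i p) 1) →
      ∀ p p', pr p = some p' → (optExp (some p')).degree < (optExp (some p)).degree := by
    intro e pr i h p p' hp
    rw [h p, hp, map_add, Finsupp.degree_single]
    exact Nat.lt_succ_self _
  have hmon : ∀ (e : ℕ) (pr : PosExp n e → Option (PosExp n e)) (i : PosExp n e → Fin n),
      (∀ p, optExp (some p) = optExp (pr p) + Finsupp.single (i p) 1) →
      ∀ p, xMonomial K n d (optExp (some p)) =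
        X (Sum.inl (i p)) * xMonomial K n d (optExp (pr p)) := by
    intro e pr i h p
    rw [h p, xMonomial_add, xMonomial_single, mul_comm]
  let M := borderedMatrix prA (fun p => (X (Sum.inl (iA p)) : URing K n d)) prB
    (fun q => X (Sum.inl (iB q))) L
  let e := (Fintype.equivFin (Option (PosExp n a ⊕ PosExp n b))).symm
  refine ⟨M.submatrix e e, fun i j => ?_, ?_⟩
  · rw [Matrix.submatrix_apply]
    rcases e i with _ | p | q <;> rcases e j with _ | p' | q'
    all_goals first
      | exact hL _ _
      | exact relationRow_mem_span _ _ _ _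
      | exact Submodule.zero_mem _
  · rw [Matrix.det_submatrix_equiv_self, det_borderedMatrix
      (v := fun o => xMonomial K n d (optExp o))
      (w := fun o => xMonomial K n d (optExp o)) (hv₀ := xMonomial_zero K n d)
      (hw₀ := xMonomial_zero K n d) (hv := hmon a prA iA hA) (hw := hmon b prB iB hB)
      (hA := hrank a prA iA hA) (hB := hrank b prB iB hB)]
    have hterm : ∀ γ : ExpLE n d, (X (Sum.inr γ) * ∏ i, X (Sum.inl i) ^ γ.1 i : URing K n d) =
        ∑ o, ∑ o', xMonomial K n d (optExp o) *
          (if oB γ = o ∧ oA γ = o' then X (Sum.inr γ) * xMonomial K n d (δ γ) else 0) *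
            xMonomial K n d (optExp o') := fun γ => by
      rw [Finset.sum_eq_single (oB γ), Finset.sum_eq_single (oA γ)]
      · change _ * xMonomial K n d γ.1 = _
        rw [hδ γ, xMonomial_add, xMonomial_add, if_pos ⟨rfl, rfl⟩]
        ring
      · intro o' _ h
        simp [h.symm]
      · simp
      · intro o _ h
        simp [h.symm]
      · simp
    symm
    rw [genPoly, Finset.sum_congr rfl fun γ _ => hterm γ, Finset.sum_comm]
    refine Finset.sum_congr rfl fun o _ => ?_
    rw [Finset.sum_comm]
    refine Finset.sum_congr rfl fun o' _ => ?_
    rw [Finset.mul_sum, Finset.sum_mul]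

end Representation

/-- For `d ≥ 1`, taking `V = F_{⌈(d−1)/2⌉}` and `W = F_{⌊(d−1)/2⌋}` yields
`N*(n,d) ≤ binom(n + ⌈(d−1)/2⌉, n) + binom(n + ⌊(d−1)/2⌋, n) − 1` (in natural numbers,
`⌈(d−1)/2⌉ = d/2` and `⌊(d−1)/2⌋ = (d−1)/2`). -/
theorem Nstar_le_half_degree (K : Type*) [Field K] (n d : ℕ) (hn : 1 ≤ n) (hd : 1 ≤ d) :
    Nstar K n d ≤ (n + d / 2).choose n + (n + (d - 1) / 2).choose n - 1 := by
  have hA := card_option_PosExp_le n (d / 2)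
  have hB := card_option_PosExp_le n ((d - 1) / 2)
  refine (Nat.sInf_le (exists_isUDR (a := d / 2) (b := (d - 1) / 2) (by omega))).trans ?_
  rw [Fintype.card_option, Fintype.card_sum]
  omega
end

section
/- Let K be a field, let n = 2m with m ≥ 1, and let d ≥ 0. Then N*(n,d) ≤ 2·binom(m+d, m) − 1: taking V to be the space of polynomials in x_1,…,x_m of degree at most d and W the space of polynomials in x_{m+1},…,x_n of degree at most d yields a uniform determinantal representation of p_{n,d} of size 2·binom(m+d,m) − 1. -/
open MvPolynomial

section Determinants

open Matrix

variable {R : Type*} [CommRing R] {U J : Type*} [Fintype U] [DecidableEq U]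
  [Fintype J] [DecidableEq J]

theorem det_fromBlocks_one_neg_one_zero (Q : Matrix J J R) :
    (fromBlocks Q 1 (-1) (0 : Matrix J J R)).det = 1 := by
  have h : fromBlocks Q 1 (-1) (0 : Matrix J J R) =
      fromBlocks 1 (1 - Q) 0 1 * fromBlocks 1 0 (-1) 1 * fromBlocks 1 1 0 (1 : Matrix J J R) := by
    simp [fromBlocks_multiply]
  rw [h, det_mul, det_mul]
  simp

theorem det_fromBlocks_bordered_s14 [Unique U] (Q : Matrix (U ⊕ J) (U ⊕ J) R) :
    (fromBlocks Q ((1 : Matrix (U ⊕ J) (U ⊕ J) R).submatrix id Sum.inr)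
      (-((1 : Matrix (U ⊕ J) (U ⊕ J) R).submatrix Sum.inr id)) 0).det =
      Q (Sum.inl default) (Sum.inl default) := by
  set D : Matrix (J ⊕ J) (J ⊕ J) R := fromBlocks Q.toBlocks₂₂ 1 (-1) 0 with hD
  have hinv : fromBlocks 0 (-1) 1 Q.toBlocks₂₂ * D = 1 := by
    simp [hD, fromBlocks_multiply]
  have hinv' : D * fromBlocks 0 (-1) 1 Q.toBlocks₂₂ = 1 := by
    simp [hD, fromBlocks_multiply]
  let : Invertible D := ⟨fromBlocks 0 (-1) 1 Q.toBlocks₂₂, hinv, hinv'⟩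
  have hD1 : D.det = 1 := det_fromBlocks_one_neg_one_zero _
  rw [← det_submatrix_equiv_self (Equiv.sumAssoc U J J).symm]
  have h : (fromBlocks Q ((1 : Matrix (U ⊕ J) (U ⊕ J) R).submatrix id Sum.inr)
      (-((1 : Matrix (U ⊕ J) (U ⊕ J) R).submatrix Sum.inr id)) 0).submatrix
        (Equiv.sumAssoc U J J).symm (Equiv.sumAssoc U J J).symm =
      fromBlocks Q.toBlocks₁₁ (fromCols Q.toBlocks₁₂ 0) (fromRows Q.toBlocks₂₁ 0) D := by
    ext (i | i | i) (j | j | j) <;> simp [hD, one_apply, toBlocks₁₁, toBlocks₁₂, toBlocks₂₁, toBlocks₂₂]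
  rw [h, det_fromBlocks₂₂, hD1, one_mul]
  have h2 : fromCols Q.toBlocks₁₂ (0 : Matrix U J R) * ⅟D * fromRows Q.toBlocks₂₁ (0 : Matrix J U R) = 0 := by
    change fromCols Q.toBlocks₁₂ (0 : Matrix U J R) * fromBlocks 0 (-1) 1 Q.toBlocks₂₂ * _ = _
    simp [fromCols_mul_fromBlocks, fromCols_mul_fromRows]
  rw [h2, sub_zero, det_unique]
  rfl

theorem det_fromBlocks_of_mulVec_eq_single [Unique U] {T S : Matrix (U ⊕ J) (U ⊕ J) R}
    (hT : T.det = 1) (hS : S.det = 1) {u w : U ⊕ J → R}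
    (hu : T *ᵥ u = Pi.single (Sum.inl default) 1) (hw : S *ᵥ w = Pi.single (Sum.inl default) 1)
    (L : Matrix (U ⊕ J) (U ⊕ J) R) :
    (fromBlocks L (Sᵀ.submatrix id Sum.inr) (-(T.submatrix Sum.inr id)) 0).det =
      w ⬝ᵥ L *ᵥ u := by
  have hT' : IsUnit T.det := by simp [hT]
  have hS' : IsUnit S.det := by simp [hS]
  have hTi : T⁻¹.det = 1 := by simp [det_nonsing_inv, hT]
  have hSi : (S⁻¹)ᵀ.det = 1 := by simp [det_nonsing_inv, hS]
  have hu' : u = T⁻¹.col (Sum.inl default) := by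
    rw [← mulVec_single_one, ← hu, mulVec_mulVec, nonsing_inv_mul _ hT', one_mulVec]
  have hw' : w = S⁻¹.col (Sum.inl default) := by
    rw [← mulVec_single_one, ← hw, mulVec_mulVec, nonsing_inv_mul _ hS', one_mulVec]
  have hST : (S⁻¹)ᵀ * Sᵀ.submatrix id Sum.inr =
      (1 : Matrix (U ⊕ J) (U ⊕ J) R).submatrix id Sum.inr := by
    have : (S⁻¹)ᵀ * Sᵀ = 1 := by rw [← transpose_mul, mul_nonsing_inv _ hS', transpose_one]
    rw [← this]
    rfl
  have hTT : T.submatrix Sum.inr id * T⁻¹ =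
      (1 : Matrix (U ⊕ J) (U ⊕ J) R).submatrix Sum.inr id := by
    rw [← mul_nonsing_inv _ hT']
    rfl
  have h : fromBlocks (S⁻¹)ᵀ 0 0 1 *
      fromBlocks L (Sᵀ.submatrix id Sum.inr) (-(T.submatrix Sum.inr id)) 0 *
      fromBlocks T⁻¹ 0 0 (1 : Matrix J J R) =
      fromBlocks ((S⁻¹)ᵀ * L * T⁻¹) ((1 : Matrix (U ⊕ J) (U ⊕ J) R).submatrix id Sum.inr)
        (-((1 : Matrix (U ⊕ J) (U ⊕ J) R).submatrix Sum.inr id)) 0 := by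
    simp [fromBlocks_multiply, hST, hTT]
  have h2 := congrArg det h
  rw [det_fromBlocks_bordered_s14, det_mul, det_mul, det_fromBlocks_zero₂₁, det_fromBlocks_zero₂₁,
    hTi, hSi] at h2
  simp only [det_one, one_mul, mul_one] at h2
  rw [h2, hu', hw', dotProduct_mulVec]
  rfl

end Determinants

section PredecessorMatrix

open Matrix

variable {R : Type*} [CommRing R] {I : Type*} [Fintype I] [DecidableEq I]

/-- The matrix whose row `a ≠ z` expresses the relation `u a = v a * u (pr a)`, and whose
row `z` is the standard basis vector at `z`. -/
def predMatrix (z : I) (pr : I → I) (v : I → R) : Matrix I I R :=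
  of fun a b => (if a = b then 1 else 0) - if a = z then 0 else if pr a = b then v a else 0

theorem det_predMatrix (z : I) (pr : I → I) (v : I → R) (deg : I → ℕ)
    (hdeg : ∀ a, a ≠ z → deg (pr a) < deg a) : (predMatrix z pr v).det = 1 := by
  have htri : (predMatrix z pr v).BlockTriangular (OrderDual.toDual ∘ deg) := by
    intro a b hab
    replace hab : deg a < deg b := hab
    have h1 : a ≠ b := by rintro rfl; exact lt_irrefl _ hab
    have h2 : a ≠ z → pr a ≠ b := by
      rintro h rfl
      exact lt_asymm hab (hdeg a h)
    by_cases hz : a = z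
    · subst hz
      simp [predMatrix, h1]
    · simp [predMatrix, h1, h2 hz]
  rw [htri.det]
  refine Finset.prod_eq_one fun k _ => ?_
  have : (predMatrix z pr v).toSquareBlock (OrderDual.toDual ∘ deg) k = 1 := by
    ext ⟨a, ha⟩ ⟨b, hb⟩
    have hab : deg a = deg b := OrderDual.toDual.injective (ha.trans hb.symm)
    have h2 : a ≠ z → pr a ≠ b := by
      rintro h rfl
      exact absurd (hdeg a h) (by omega)
    by_cases hz : a = z
    · subst hz
      simp [predMatrix, toSquareBlock_def, one_apply]
    · simp [predMatrix, toSquareBlock_def, one_apply, h2 hz, hz]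
  rw [this, det_one]

theorem predMatrix_mulVec (z : I) (pr : I → I) (v u : I → R) (hz : u z = 1)
    (hu : ∀ a, a ≠ z → u a = v a * u (pr a)) :
    predMatrix z pr v *ᵥ u = Pi.single z 1 := by
  ext a
  by_cases h : a = z
  · subst h
    simp [predMatrix, mulVec, dotProduct, hz]
  · simp [predMatrix, mulVec, dotProduct, sub_mul, Finset.sum_sub_distrib, h, ← hu a h]

end PredecessorMatrix

namespace ExpLE

/-- The zero exponent vector. -/
def zero (n d : ℕ) : ExpLE n d := ⟨0, by simp⟩

theorem sum_le {n d : ℕ} (a : ExpLE n d) : ∑ i, a.1 i ≤ d := by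
  rw [← Finsupp.sum_fintype a.1 (fun _ e => e) (fun _ => rfl)]
  exact a.2

theorem exists_pred (n d : ℕ) (a : ExpLE n d) (ha : a ≠ zero n d) :
    ∃ (b : ExpLE n d) (i : Fin n), a.1 = b.1 + Finsupp.single i 1 := by
  obtain ⟨i, hi⟩ : ∃ i, a.1 i ≠ 0 := by
    by_contra! h
    exact ha (Subtype.ext (Finsupp.ext h))
  have hle : Finsupp.single i 1 ≤ a.1 := by simpa [Nat.one_le_iff_ne_zero] using hi
  refine ⟨⟨a.1 - Finsupp.single i 1, ?_⟩, i, (tsub_add_cancel_of_le hle).symm⟩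
  rw [Finsupp.sum_fintype _ _ (fun _ => rfl)]
  refine le_trans (Finset.sum_le_sum fun j _ => ?_) a.sum_le
  simp

/-- The restriction of an exponent vector along an injective map of variables. -/
noncomputable def restrict {n m d : ℕ} (f : Fin m ↪ Fin n) (a : ExpLE n d) : ExpLE m d :=
  ⟨a.1.comapDomain f f.injective.injOn, by
    rw [Finsupp.sum_fintype _ _ (fun _ => rfl)]
    exact ((Finset.sum_map Finset.univ f fun i => a.1 i).symm.trans_le
      (Finset.sum_le_sum_of_subset (Finset.subset_univ _))).trans a.sum_le⟩

theorem card_le (m d : ℕ) : Fintype.card (ExpLE m d) ≤ (m + d).choose m := by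
  have hsum (a : ExpLE m d) : a.1.toMultiset.card = ∑ i, a.1 i := by
    rw [Finsupp.card_toMultiset, Finsupp.sum_fintype _ _ (fun _ => rfl)]
    rfl
  let f : ExpLE m d → Sym (Option (Fin m)) d := fun a =>
    ⟨a.1.toMultiset.map some + Multiset.replicate (d - ∑ i, a.1 i) none, by
      have := a.sum_le
      simp only [Multiset.card_add, Multiset.card_map, Multiset.card_replicate, hsum]
      omega⟩
  have hf : Function.Injective f := by
    intro a b h
    refine Subtype.ext (Finsupp.ext fun i => ?_)
    have h1 := congrArg (Multiset.count (some i)) (congrArg Subtype.val h)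
    simpa [f, Multiset.count_map_eq_count' _ _ (Option.some_injective _),
      Multiset.count_replicate] using h1
  refine (Fintype.card_le_of_injective f hf).trans_eq ?_
  rw [Sym.card_sym_eq_choose, Fintype.card_option, Fintype.card_fin]
  have : m + 1 + d - 1 = m + d := by omega
  rw [this, Nat.choose_symm_add]

end ExpLE

section Construction

open Matrix

variable {K : Type*} [Field K] {n d : ℕ}

theorem one_mem_span_allowed : (1 : URing K n d) ∈ Submodule.span K (allowedMonomials K n d) :=
  Submodule.subset_span (by simp [allowedMonomials])

theorem X_inl_mem_span_allowed (i : Fin n) :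
    (X (Sum.inl i) : URing K n d) ∈ Submodule.span K (allowedMonomials K n d) :=
  Submodule.subset_span (by simp [allowedMonomials])

theorem X_inr_mem_span_allowed (α : ExpLE n d) :
    (X (Sum.inr α) : URing K n d) ∈ Submodule.span K (allowedMonomials K n d) :=
  Submodule.subset_span (by simp [allowedMonomials])

/-- The monomials in the variables selected by `f` are cut out by a unimodular matrix with
affine-linear entries. -/
theorem exists_monomial_matrix {m : ℕ} (f : Fin m ↪ Fin n) :
    ∃ T : Matrix (ExpLE m d) (ExpLE m d) (URing K n d),
      (∀ a b, T a b ∈ Submodule.span K (allowedMonomials K n d)) ∧ T.det = 1 ∧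
      T *ᵥ (fun a => ∏ i, X (Sum.inl (f i)) ^ a.1 i) = Pi.single (ExpLE.zero m d) 1 := by
  classical
  have key : ∀ a : ExpLE m d, ∃ (b : ExpLE m d) (x : URing K n d),
      x ∈ Submodule.span K (allowedMonomials K n d) ∧ (a ≠ ExpLE.zero m d →
        ∑ i, b.1 i < ∑ i, a.1 i ∧
        (∏ i, X (Sum.inl (f i)) ^ a.1 i : URing K n d) =
          x * ∏ i, X (Sum.inl (f i)) ^ b.1 i) := by
    intro a
    by_cases ha : a = ExpLE.zero m d
    · exact ⟨a, 0, zero_mem _, fun h => absurd ha h⟩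
    obtain ⟨b, i, h⟩ := ExpLE.exists_pred m d a ha
    refine ⟨b, X (Sum.inl (f i)), X_inl_mem_span_allowed _, fun _ => ⟨?_, ?_⟩⟩
    · simp [h, Finset.sum_add_distrib, Finsupp.single_apply]
    · simp only [h, Finsupp.add_apply, Finsupp.single_apply, pow_add, Finset.prod_mul_distrib, pow_ite,
        pow_one, pow_zero, Finset.prod_ite_eq, Finset.mem_univ, if_true, mul_comm]
  choose pr v hv h using key
  refine ⟨predMatrix (ExpLE.zero m d) pr v, fun a b => ?_,
    det_predMatrix _ _ _ (fun a => ∑ i, a.1 i) fun a ha => (h a ha).1,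
    predMatrix_mulVec _ _ _ _ (by simp [ExpLE.zero]) fun a ha => (h a ha).2⟩
  refine sub_mem ?_ ?_
  · split_ifs
    exacts [one_mem_span_allowed, zero_mem _]
  · split_ifs
    exacts [zero_mem _, hv a, zero_mem _]

/-- Any two complementary families of variables yield a uniform determinantal representation. -/
theorem exists_isUDR_s14 {m : ℕ} (e : Fin m ⊕ Fin m ≃ Fin n) :
    ∃ M : Matrix (Fin (2 * Fintype.card (ExpLE m d) - 1))
      (Fin (2 * Fintype.card (ExpLE m d) - 1)) (URing K n d), IsUDR K n d _ M := by
  classical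
  let f : Fin m ↪ Fin n := Function.Embedding.inl.trans e.toEmbedding
  let g : Fin m ↪ Fin n := Function.Embedding.inr.trans e.toEmbedding
  obtain ⟨T, hTmem, hTdet, hT⟩ := exists_monomial_matrix (K := K) (d := d) f
  obtain ⟨S, hSmem, hSdet, hS⟩ := exists_monomial_matrix (K := K) (d := d) g
  set u : ExpLE m d → URing K n d := fun a => ∏ i, X (Sum.inl (f i)) ^ a.1 i
  set w : ExpLE m d → URing K n d := fun a => ∏ i, X (Sum.inl (g i)) ^ a.1 i
  let L : Matrix (ExpLE m d) (ExpLE m d) (URing K n d) := of fun b a =>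
    ∑ α : ExpLE n d, if α.restrict g = b then
      (if α.restrict f = a then X (Sum.inr α) else 0) else 0
  have hL : w ⬝ᵥ L *ᵥ u = genPoly K n d := by
    have hα (α : ExpLE n d) : ∏ i, (X (Sum.inl i) : URing K n d) ^ α.1 i =
        u (α.restrict f) * w (α.restrict g) := by
      rw [← e.prod_comp, Fintype.prod_sum_type]
      rfl
    simp only [genPoly, hα, dotProduct, mulVec, L, of_apply, Finset.mul_sum, Finset.sum_mul]
    calc _ = ∑ b, ∑ α : ExpLE n d, ∑ a, _ := Finset.sum_congr rfl fun b _ => Finset.sum_comm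
      _ = ∑ α : ExpLE n d, ∑ b, ∑ a, _ := Finset.sum_comm
      _ = _ := Finset.sum_congr rfl fun α _ => ?_
    simp [ite_mul, mul_ite]
    ring
  let z := ExpLE.zero m d
  let q : {a : ExpLE m d // a = z} ⊕ {a : ExpLE m d // ¬ a = z} ≃ ExpLE m d :=
    Equiv.sumCompl (· = z)
  have hq (A : Matrix (ExpLE m d) (ExpLE m d) (URing K n d)) (x : ExpLE m d → URing K n d)
      (h : A *ᵥ x = Pi.single z 1) :
      A.submatrix q q *ᵥ (x ∘ q) = Pi.single (Sum.inl default) 1 := by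
    rw [submatrix_mulVec_equiv, Function.comp_assoc, Equiv.self_comp_symm, Function.comp_id, h]
    have hz (i) : q i = z ↔ i = Sum.inl default := q.injective.eq_iff' rfl
    ext i
    simp [Pi.single_apply, hz]
  have hdet := det_fromBlocks_of_mulVec_eq_single (T := T.submatrix q q) (S := S.submatrix q q)
    (by simpa using hTdet) (by simpa using hSdet) (hq T u hT) (hq S w hS) (L.submatrix q q)
  have hcard : Fintype.card (({a : ExpLE m d // a = z} ⊕ {a : ExpLE m d // ¬ a = z}) ⊕
      {a : ExpLE m d // ¬ a = z}) = 2 * Fintype.card (ExpLE m d) - 1 := by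
    have h1 := Fintype.card_congr q
    rw [Fintype.card_sum, Fintype.card_unique] at h1
    rw [Fintype.card_sum, Fintype.card_sum, Fintype.card_unique]
    omega
  let r := (Fintype.equivFinOfCardEq hcard).symm
  refine ⟨(fromBlocks (L.submatrix q q) ((S.submatrix q q)ᵀ.submatrix id Sum.inr)
    (-((T.submatrix q q).submatrix Sum.inr id)) 0).submatrix r r, fun i j => ?_, ?_⟩
  rotate_left
  · rw [det_submatrix_equiv_self, hdet, submatrix_mulVec_equiv, Function.comp_assoc,
      Equiv.self_comp_symm, Function.comp_id, comp_equiv_dotProduct_comp_equiv, hL]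
  · rw [submatrix_apply]
    rcases r i with i | i <;> rcases r j with j | j
    · refine sum_mem fun α _ => ?_
      split_ifs
      exacts [X_inr_mem_span_allowed α, zero_mem _, zero_mem _]
    · exact hSmem _ _
    · exact neg_mem (hTmem _ _)
    · exact zero_mem _

end Construction

/-- Theorem 1.3, upper bound for even `n`. For `n = 2m` with `m ≥ 1`,
splitting the variables into two groups of size `m` of degree at most `d` each yields
`N*(n,d) ≤ 2·binom(m+d, m) − 1`. -/
theorem Nstar_even_upper_bound (K : Type*) [Field K] (m d : ℕ) (hm : 1 ≤ m) :
    Nstar K (2 * m) d ≤ 2 * (m + d).choose m - 1 := by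
  have h := ExpLE.card_le m d
  refine (Nat.sInf_le (exists_isUDR_s14 (K := K) (d := d)
    (finSumFinEquiv.trans (finCongr (two_mul m).symm)))).trans ?_
  omega
end

section
/- Let K be a field and d ≥ 1 an integer. Then N*(2,d) ≤ 2d − 1: the generic bivariate polynomial p_{2,d} = Σ_{i+j≤d} c_{ij} x^i y^j admits a uniform determinantal representation of size 2d − 1. -/
open MvPolynomial

/-- If `A` and `B` become unimodular after deleting the column (resp. row) of index `0`, and
`v`, `w` are normalised kernel vectors of `A` and `B`, then the determinant of the block matrix
with blocks `L`, `A`, `B`, `0` is the value `w L v` of the bilinear form `L`. -/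
theorem det_bordered_eq_bilinear {R : Type*} [CommRing R] {m n : ℕ}
    (A : Matrix (Fin m) (Fin (m + 1)) R) (B : Matrix (Fin (n + 1)) (Fin n) R)
    (L : Matrix (Fin (n + 1)) (Fin (m + 1)) R) (v : Fin (m + 1) → R) (w : Fin (n + 1) → R)
    (hA : (A.submatrix id Fin.succ).det = 1) (hB : (B.submatrix Fin.succ id).det = 1)
    (hv : A.mulVec v = 0) (hw : Matrix.vecMul w B = 0) (hv0 : v 0 = 1) (hw0 : w 0 = 1) :
    (Matrix.fromBlocks (Matrix.of fun _ _ : Unit => L 0 0)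
      (Matrix.of fun _ : Unit => Sum.elim (fun i => L 0 (Fin.succ i)) (B 0))
      (Matrix.of fun k (_ : Unit) => Sum.elim (fun i => A i 0) (fun j => L (Fin.succ j) 0) k)
      (Matrix.fromBlocks (A.submatrix id Fin.succ) 0
        (L.submatrix Fin.succ Fin.succ) (B.submatrix Fin.succ id))).det =
      ∑ j, ∑ i, w j * L j i * v i := by
  set D := Matrix.fromBlocks (A.submatrix id Fin.succ) 0
        (L.submatrix Fin.succ Fin.succ) (B.submatrix Fin.succ id)
  set M := Matrix.fromBlocks (Matrix.of fun _ _ : Unit => L 0 0)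
      (Matrix.of fun _ : Unit => Sum.elim (fun i => L 0 (Fin.succ i)) (B 0))
      (Matrix.of fun k (_ : Unit) => Sum.elim (fun i => A i 0) (fun j => L (Fin.succ j) 0) k)
      D
  let P : Matrix (Unit ⊕ (Fin m ⊕ Fin n)) (Unit ⊕ (Fin m ⊕ Fin n)) R :=
    Matrix.fromBlocks 1 (Matrix.of fun _ => Sum.elim 0 fun j => w (Fin.succ j)) 0 1
  let Q : Matrix (Unit ⊕ (Fin m ⊕ Fin n)) (Unit ⊕ (Fin m ⊕ Fin n)) R :=
    Matrix.fromBlocks 1 0 (Matrix.of fun k _ => Sum.elim (fun i => v (Fin.succ i)) 0 k) 1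
  have hP : P.det = 1 := by simp [P]
  have hQ : Q.det = 1 := by simp [Q]
  have hPMQ : P * M * Q = Matrix.fromBlocks
      (Matrix.of fun _ _ : Unit => ∑ j, ∑ i, w j * L j i * v i)
      (Matrix.of fun _ : Unit => Sum.elim
        (fun i => L 0 (Fin.succ i) + ∑ j, w (Fin.succ j) * L (Fin.succ j) (Fin.succ i)) 0)
      (Matrix.of fun k (_ : Unit) => Sum.elim 0
        (fun j => L (Fin.succ j) 0 + ∑ i, L (Fin.succ j) (Fin.succ i) * v (Fin.succ i)) k) D := by
    have hv' : ∀ i, A i 0 + ∑ k : Fin m, A i k.succ * v k.succ = 0 := fun i => by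
      have := congrFun hv i
      simpa [Matrix.mulVec, dotProduct, Fin.sum_univ_succ, hv0] using this
    have hw' : ∀ j, B 0 j + ∑ k : Fin n, w k.succ * B k.succ j = 0 := fun j => by
      have := congrFun hw j
      simpa [Matrix.vecMul, dotProduct, Fin.sum_univ_succ, hw0] using this
    simp only [P, Q, M, Matrix.fromBlocks_multiply]
    congr 1
    · ext
      simp [D, Matrix.mul_apply, Fin.sum_univ_succ, hv0, hw0, Finset.sum_add_distrib,
        Finset.sum_mul, add_mul]
      rw [Finset.sum_comm]
    · ext _ (i | j)
      · simp [D, Matrix.mul_apply]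
      · simpa [D, Matrix.mul_apply] using hw' j
    · ext (i | j) _
      · simpa [D, Matrix.mul_apply] using hv' i
      · simp [D, Matrix.mul_apply]
    · simp
  have hs : (P * M * Q).det = ∑ j, ∑ i, w j * L j i * v i := by
    set r : Fin m → R := fun i =>
      L 0 (Fin.succ i) + ∑ j, w (Fin.succ j) * L (Fin.succ j) (Fin.succ i)
    set c : Fin n → R := fun j =>
      L (Fin.succ j) 0 + ∑ i, L (Fin.succ j) (Fin.succ i) * v (Fin.succ i)
    set s := ∑ j, ∑ i, w j * L j i * v i
    have hassoc : (P * M * Q).submatrix (Equiv.sumAssoc Unit (Fin m) (Fin n))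
        (Equiv.sumAssoc Unit (Fin m) (Fin n)) = Matrix.fromBlocks
          (Matrix.fromBlocks (Matrix.of fun _ _ : Unit => s) (Matrix.of fun _ : Unit => r) 0
            (A.submatrix id Fin.succ)) 0
          (Matrix.of fun j => Sum.elim (fun _ => c j) fun i => L (Fin.succ j) (Fin.succ i))
          (B.submatrix Fin.succ id) := by
      rw [hPMQ]
      ext ((_ | i) | i) ((_ | j) | j) <;> simp [D]
    rw [← Matrix.det_submatrix_equiv_self (Equiv.sumAssoc Unit (Fin m) (Fin n)), hassoc,
      Matrix.det_fromBlocks_zero₁₂, Matrix.det_fromBlocks_zero₂₁, hA, hB]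
    simp
  rwa [Matrix.det_mul, Matrix.det_mul, hP, hQ, one_mul, mul_one] at hs

/-- The bidiagonal `m × (m + 1)` matrix annihilating the vector `(1, r, …, r ^ m)`. -/
def powerRelations {R : Type*} [CommRing R] (m : ℕ) (r : R) : Matrix (Fin m) (Fin (m + 1)) R :=
  Matrix.of fun i j => if j = i.succ then 1 else if j = i.castSucc then -r else 0

theorem powerRelations_mulVec {R : Type*} [CommRing R] (m : ℕ) (r : R) :
    (powerRelations m r).mulVec (fun j => r ^ (j : ℕ)) = 0 := by
  ext i
  have h : ∀ j : Fin (m + 1), powerRelations m r i j * r ^ (j : ℕ) =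
      (if j = i.succ then r ^ (j : ℕ) else 0) +
        (if j = i.castSucc then -r * r ^ (j : ℕ) else 0) := by
    intro j
    have := (Fin.castSucc_lt_succ (i := i)).ne
    simp only [powerRelations, Matrix.of_apply]
    split_ifs <;> simp_all
  simp [Matrix.mulVec, dotProduct, h, Finset.sum_add_distrib, pow_succ']

theorem det_powerRelations_submatrix {R : Type*} [CommRing R] (m : ℕ) (r : R) :
    ((powerRelations m r).submatrix id Fin.succ).det = 1 := by
  rw [Matrix.det_of_isLowerTriangular]
  · simp [powerRelations]
  · intro i j hij
    have hij : i < j := by simpa using hij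
    have h1 : j ≠ i := hij.ne'
    have h2 : j.succ ≠ i.castSucc := by
      simp only [ne_eq, Fin.ext_iff, Fin.val_succ, Fin.val_castSucc]
      omega
    simp [powerRelations, h1, h2]

theorem one_mem_span_allowedMonomials (K : Type*) [Field K] (n d : ℕ) :
    (1 : URing K n d) ∈ Submodule.span K (allowedMonomials K n d) :=
  Submodule.subset_span (by simp [allowedMonomials])

theorem X_inl_mem_span_allowedMonomials (K : Type*) [Field K] {n d : ℕ} (i : Fin n) :
    (X (Sum.inl i) : URing K n d) ∈ Submodule.span K (allowedMonomials K n d) :=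
  Submodule.subset_span (by simp [allowedMonomials])

theorem X_inr_mem_span_allowedMonomials (K : Type*) [Field K] {n d : ℕ} (α : ExpLE n d) :
    (X (Sum.inr α) : URing K n d) ∈ Submodule.span K (allowedMonomials K n d) :=
  Submodule.subset_span (by simp [allowedMonomials])

theorem X_inr_mul_X_inl_mem_span_allowedMonomials (K : Type*) [Field K] {n d : ℕ}
    (α : ExpLE n d) (i : Fin n) : (X (Sum.inr α) * X (Sum.inl i) : URing K n d) ∈
      Submodule.span K (allowedMonomials K n d) :=
  Submodule.subset_span (Or.inr ⟨(α, i), rfl⟩)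

theorem powerRelations_mem_span_allowedMonomials (K : Type*) [Field K] {n d m : ℕ} (k : Fin n)
    (i : Fin m) (j : Fin (m + 1)) : powerRelations m (X (Sum.inl k) : URing K n d) i j ∈
      Submodule.span K (allowedMonomials K n d) := by
  simp only [powerRelations, Matrix.of_apply]
  split_ifs
  · exact one_mem_span_allowedMonomials K n d
  · exact neg_mem (X_inl_mem_span_allowedMonomials K k)
  · exact zero_mem _

theorem ExpLE.add_le {d : ℕ} (α : ExpLE 2 d) : α.1 0 + α.1 1 ≤ d := by
  have := α.2
  rwa [Finsupp.sum_fintype _ _ (fun _ => rfl), Fin.sum_univ_two] at this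

/-- The matrix whose value at `(1, y, …, y ^ m)`, `(1, x, …, x ^ m)` is the generic bivariate
polynomial of degree `m + 1`. -/
noncomputable def coeffMatrix (K : Type*) [Field K] (m : ℕ) :
    Matrix (Fin (m + 1)) (Fin (m + 1)) (URing K 2 (m + 1)) :=
  Matrix.of fun j i => ∑ α : ExpLE 2 (m + 1),
    if (j : ℕ) = min (α.1 1) m ∧ (i : ℕ) = min (α.1 0) m then
      X (Sum.inr α) * (X (Sum.inl 0) ^ (α.1 0 - m) * X (Sum.inl 1) ^ (α.1 1 - m))
    else 0

theorem coeffMatrix_mem_span_allowedMonomials (K : Type*) [Field K] (m : ℕ)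
    (j i : Fin (m + 1)) :
    coeffMatrix K m j i ∈ Submodule.span K (allowedMonomials K 2 (m + 1)) := by
  refine Submodule.sum_mem _ fun α _ => ?_
  split_ifs
  · have h := α.add_le
    have h' : (α.1 0 - m = 0 ∧ α.1 1 - m = 0) ∨ (α.1 0 - m = 1 ∧ α.1 1 - m = 0) ∨
        (α.1 0 - m = 0 ∧ α.1 1 - m = 1) := by omega
    rcases h' with ⟨h0, h1⟩ | ⟨h0, h1⟩ | ⟨h0, h1⟩ <;> rw [h0, h1]
    · simpa using X_inr_mem_span_allowedMonomials K α
    · simpa using X_inr_mul_X_inl_mem_span_allowedMonomials K α 0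
    · simpa using X_inr_mul_X_inl_mem_span_allowedMonomials K α 1
  · exact zero_mem _

theorem sum_coeffMatrix (K : Type*) [Field K] (m : ℕ) :
    ∑ j : Fin (m + 1), ∑ i : Fin (m + 1),
      X (Sum.inl 1) ^ (j : ℕ) * coeffMatrix K m j i * X (Sum.inl 0) ^ (i : ℕ) =
      genPoly K 2 (m + 1) := by
  simp only [coeffMatrix, Matrix.of_apply, Finset.mul_sum, Finset.sum_mul]
  simp_rw [Finset.sum_comm (s := (Finset.univ : Finset (Fin (m + 1))))
    (t := (Finset.univ : Finset (ExpLE 2 (m + 1))))]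
  refine Finset.sum_congr rfl fun α _ => ?_
  rw [Finset.sum_eq_single (⟨min (α.1 1) m, by omega⟩ : Fin (m + 1)),
    Finset.sum_eq_single (⟨min (α.1 0) m, by omega⟩ : Fin (m + 1))]
  · have h0 : α.1 0 = min (α.1 0) m + (α.1 0 - m) := by omega
    have h1 : α.1 1 = min (α.1 1) m + (α.1 1 - m) := by omega
    rw [Fin.prod_univ_two]
    conv_rhs => rw [h0, h1, pow_add, pow_add]
    simp only [and_self, if_true]
    ring
  · intro i _ hi
    have : (i : ℕ) ≠ min (α.1 0) m := fun h => hi (Fin.ext h)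
    simp [this]
  · simp
  · intro j _ hj
    have : (j : ℕ) ≠ min (α.1 1) m := fun h => hj (Fin.ext h)
    simp [this]
  · simp

/-- Example 5.3. For `d ≥ 1`, the generic bivariate polynomial of degree
`d` admits a uniform determinantal representation of size `2d − 1`: `N*(2,d) ≤ 2d − 1`. -/
theorem Nstar_two_vars (K : Type*) [Field K] (d : ℕ) (hd : 1 ≤ d) :
    Nstar K 2 d ≤ 2 * d - 1 := by
  obtain ⟨m, rfl⟩ : ∃ m, d = m + 1 := ⟨d - 1, by omega⟩
  let e : Unit ⊕ (Fin m ⊕ Fin m) ≃ Fin (2 * (m + 1) - 1) :=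
    Fintype.equivFinOfCardEq (by simp; omega)
  refine Nat.sInf_le ⟨Matrix.reindex e e _, fun i j => ?_, (Matrix.det_reindex_self e _).trans <|
    (det_bordered_eq_bilinear (powerRelations m (X (Sum.inl 0)))
      (powerRelations m (X (Sum.inl 1))).transpose (coeffMatrix K m)
      (fun i => X (Sum.inl 0) ^ (i : ℕ))
      (fun j => X (Sum.inl 1) ^ (j : ℕ)) (det_powerRelations_submatrix _ _) ?_
      (powerRelations_mulVec _ _) ?_ (by simp) (by simp)).trans (sum_coeffMatrix K m)⟩
  · rw [Matrix.reindex_apply, Matrix.submatrix_apply]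
    rcases e.symm i with _ | i | i <;> rcases e.symm j with _ | j | j
    all_goals
      simp only [Matrix.fromBlocks_apply₁₁, Matrix.fromBlocks_apply₁₂, Matrix.fromBlocks_apply₂₁,
        Matrix.fromBlocks_apply₂₂, Matrix.of_apply, Sum.elim_inl, Sum.elim_inr,
        Matrix.submatrix_apply, Matrix.transpose_apply, Matrix.zero_apply, id_eq, zero_mem,
        coeffMatrix_mem_span_allowedMonomials, powerRelations_mem_span_allowedMonomials]
  · rw [← Matrix.det_transpose]
    exact det_powerRelations_submatrix _ _
  · rw [Matrix.vecMul_transpose]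
    exact powerRelations_mulVec _ _
end

section
/- Let K be a field. Then N*(2,2) = 3: the generic bivariate quadric p_{2,2} admits a uniform determinantal representation of size 3, and admits no uniform determinantal representation of size 2. -/
open MvPolynomial

/-- The polarization of the determinant of `2 × 2` matrices. -/
def detPolar {K : Type*} [Field K] (A B : Matrix (Fin 2) (Fin 2) K) : K :=
  A 0 0 * B 1 1 + A 1 1 * B 0 0 - A 0 1 * B 1 0 - A 1 0 * B 0 1

lemma exists_sum_smul_eq_zero_of_detPolar {K : Type*} [Field K]
    (v : Fin 3 → Matrix (Fin 2) (Fin 2) K) (h : ∀ i j, detPolar (v i) (v j) = 0) :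
    ∃ g : Fin 3 → K, ∑ i, g i • v i = 0 ∧ ∃ i, g i ≠ 0 := by
  rw [← Fintype.not_linearIndependent_iff]
  intro hv
  let V : Matrix (Fin 3) (Fin 4) K := .of fun i => ![v i 0 0, v i 0 1, v i 1 0, v i 1 1]
  let J : Matrix (Fin 4) (Fin 4) K := !![0, 0, 0, 1; 0, 0, -1, 0; 0, -1, 0, 0; 1, 0, 0, 0]
  have hJ : J * J = 1 := by
    ext i j
    fin_cases i <;> fin_cases j <;> simp [J, Matrix.mul_apply, Fin.sum_univ_four]
  have hJdet : IsUnit J.det :=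
    (Matrix.isUnit_iff_isUnit_det J).1 (IsUnit.of_mul_eq_one J hJ)
  have hVind : LinearIndependent K V.row := by
    rw [Fintype.linearIndependent_iff] at hv ⊢
    intro g hg
    refine hv g ?_
    ext i j
    have h0 := congrFun hg 0
    have h1 := congrFun hg 1
    have h2 := congrFun hg 2
    have h3 := congrFun hg 3
    simp [V, Fin.sum_univ_three] at h0 h1 h2 h3
    fin_cases i <;> fin_cases j <;> simpa [Fin.sum_univ_three]
  have hV : V.rank = 3 := by simpa using hVind.rank_matrix
  have hzero : V * J * V.transpose = 0 := by
    ext i j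
    have := h i j
    simp only [detPolar] at this
    simp [V, J, Matrix.mul_apply, Fin.sum_univ_four]
    linear_combination this
  rw [Matrix.mul_assoc] at hzero
  have := Matrix.rank_add_rank_le_card_of_mul_eq_zero hzero
  rw [Matrix.rank_mul_eq_right_of_isUnit_det _ _ hJdet, Matrix.rank_transpose, hV] at this
  simp at this

lemma exists_eq_of_mem_span_allowedMonomials {K : Type*} [Field K] {n d : ℕ} {f : URing K n d}
    (hf : f ∈ Submodule.span K (allowedMonomials K n d)) :
    ∃ (a : K) (u : Fin n → K) (b : ExpLE n d → K) (w : ExpLE n d → Fin n → K),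
      f = C a + ∑ i, C (u i) * X (Sum.inl i) +
        ∑ β, (C (b β) + ∑ i, C (w β i) * X (Sum.inl i)) * X (Sum.inr β) := by
  induction hf using Submodule.span_induction with
  | mem f hf =>
    rcases hf with ((hf | ⟨i, rfl⟩) | ⟨β, rfl⟩) | ⟨⟨β, i⟩, rfl⟩
    · rw [Set.mem_singleton_iff] at hf
      exact ⟨1, 0, 0, 0, by simp [hf]⟩
    · exact ⟨0, Pi.single i 1, 0, 0, by simp [Pi.single_apply, apply_ite C, ite_mul]⟩
    · exact ⟨0, 0, Pi.single β 1, 0, by simp [Pi.single_apply, apply_ite C, ite_mul]⟩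
    · refine ⟨0, 0, 0, fun γ j => if γ = β then if j = i then 1 else 0 else 0, ?_⟩
      simp only [map_zero, Pi.zero_apply, zero_mul, Finset.sum_const_zero, zero_add]
      rw [Fintype.sum_eq_single β (fun γ hγ => by simp [hγ])]
      simp [apply_ite C, ite_mul, mul_comm]
  | zero => exact ⟨0, 0, 0, 0, by simp⟩
  | add f g _ _ hf hg =>
    obtain ⟨a, u, b, w, rfl⟩ := hf
    obtain ⟨a', u', b', w', rfl⟩ := hg
    refine ⟨a + a', u + u', b + b', w + w', ?_⟩
    simp only [map_add, Pi.add_apply, add_mul, Finset.sum_add_distrib]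
    ring
  | smul c f _ hf =>
    obtain ⟨a, u, b, w, rfl⟩ := hf
    refine ⟨c * a, c • u, c • b, c • w, ?_⟩
    simp only [map_mul, Pi.smul_apply, smul_eq_mul, MvPolynomial.smul_eq_C_mul, mul_add,
      add_mul, Finset.mul_sum, mul_assoc, Finset.sum_add_distrib, Finset.sum_mul]

/-- The substitution `xᵢ ↦ sᵢ T`, `c_β ↦ T³`, `c_γ ↦ 0` for `γ ≠ β`. -/
noncomputable def substLine {K : Type*} [Field K] {n d : ℕ} (s : Fin n → K) (β : ExpLE n d) :
    URing K n d →ₐ[K] Polynomial K :=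
  aeval (Sum.elim (fun i => Polynomial.C (s i) * Polynomial.X)
    fun γ => if γ = β then Polynomial.X ^ 3 else 0)

lemma substLine_genPoly {K : Type*} [Field K] {n d : ℕ} (s : Fin n → K) (β : ExpLE n d) :
    substLine s β (genPoly K n d) =
      Polynomial.C (∏ i, s i ^ β.1 i) * Polynomial.X ^ (3 + ∑ i, β.1 i) := by
  rw [genPoly, map_sum, Fintype.sum_eq_single β (fun γ hγ => by simp [substLine, hγ])]
  simp only [substLine, map_mul, map_prod, map_pow, aeval_X, Sum.elim_inl, Sum.elim_inr, if_true,
    mul_pow, Finset.prod_mul_distrib, Finset.prod_pow_eq_pow_sum]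
  ring

/-- The image under `substLine` of a linear combination of the allowed monomials. -/
noncomputable def linePoly {K : Type*} [Field K] (a u b w : K) : Polynomial K :=
  Polynomial.C a + Polynomial.C u * Polynomial.X + Polynomial.C b * Polynomial.X ^ 3 +
    Polynomial.C w * Polynomial.X ^ 4

lemma exists_substLine_eq_linePoly {K : Type*} [Field K] {n d : ℕ} {f : URing K n d}
    (hf : f ∈ Submodule.span K (allowedMonomials K n d)) :
    ∃ (a : K) (u : Fin n → K) (b : ExpLE n d → K) (w : ExpLE n d → Fin n → K),
      ∀ s β, substLine s β f = linePoly a (∑ i, s i * u i) (b β) (∑ i, s i * w β i) := by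
  obtain ⟨a, u, b, w, rfl⟩ := exists_eq_of_mem_span_allowedMonomials hf
  refine ⟨a, u, b, w, fun s β => ?_⟩
  have hsum (v : Fin n → K) : substLine s β (∑ i, C (v i) * X (Sum.inl i)) =
      Polynomial.C (∑ i, s i * v i) * Polynomial.X := by
    simp only [substLine, map_sum, map_mul, aeval_X, aeval_C, Sum.elim_inl,
      Polynomial.algebraMap_eq, Finset.sum_mul]
    exact Finset.sum_congr rfl fun i _ => by ring
  have hC (e : K) : substLine s β (C e) = Polynomial.C e := by simp [substLine]
  have hX (γ : ExpLE n d) :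
      substLine s β (X (Sum.inr γ)) = if γ = β then Polynomial.X ^ 3 else 0 := by
    simp [substLine]
  rw [map_add, map_add, hsum, hC, map_sum (substLine s β),
    Fintype.sum_eq_single β (fun γ hγ => by rw [map_mul, hX, if_neg hγ, mul_zero]),
    map_mul, map_add, hsum, hC, hX, if_pos rfl, linePoly]
  ring

lemma det_linePoly {K : Type*} [Field K] (A U B W : Matrix (Fin 2) (Fin 2) K) :
    (Matrix.of fun i j => linePoly (A i j) (U i j) (B i j) (W i j)).det =
      Polynomial.C A.det + Polynomial.C (detPolar A U) * Polynomial.X +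
        Polynomial.C U.det * Polynomial.X ^ 2 + Polynomial.C (detPolar A B) * Polynomial.X ^ 3 +
        Polynomial.C (detPolar A W + detPolar U B) * Polynomial.X ^ 4 +
        Polynomial.C (detPolar U W) * Polynomial.X ^ 5 + Polynomial.C B.det * Polynomial.X ^ 6 +
        Polynomial.C (detPolar B W) * Polynomial.X ^ 7 + Polynomial.C W.det * Polynomial.X ^ 8 := by
  simp only [Matrix.det_fin_two, Matrix.of_apply, linePoly, detPolar, map_add, map_sub, map_mul]
  ring

lemma coeff_det_linePoly {K : Type*} [Field K] {A U B W : Matrix (Fin 2) (Fin 2) K} {c : K} {k : ℕ}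
    (h : (Matrix.of fun i j => linePoly (A i j) (U i j) (B i j) (W i j)).det =
      Polynomial.C c * Polynomial.X ^ (3 + k)) :
    A.det = 0 ∧ detPolar A U = 0 ∧ U.det = 0 ∧ detPolar A B = (if k = 0 then c else 0) ∧
      detPolar A W + detPolar U B = (if k = 1 then c else 0) ∧
      detPolar U W = if k = 2 then c else 0 := by
  rw [det_linePoly] at h
  have hcoeff (m : ℕ) := congrArg (fun q => Polynomial.coeff q m) h
  simp only [Polynomial.coeff_add, Polynomial.coeff_C_mul, Polynomial.coeff_X_pow,
    Polynomial.coeff_X, Polynomial.coeff_C] at hcoeff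
  refine ⟨?_, ?_, ?_, ?_, ?_, ?_⟩
  · simpa [show ¬ 0 = 3 + k by lia] using hcoeff 0
  · simpa [show ¬ 1 = 3 + k by lia] using hcoeff 1
  · simpa [show ¬ 2 = 3 + k by lia] using hcoeff 2
  · simpa [show 3 = 3 + k ↔ k = 0 by lia] using hcoeff 3
  · simpa [show 4 = 3 + k ↔ k = 1 by lia] using hcoeff 4
  · simpa [show 5 = 3 + k ↔ k = 2 by lia] using hcoeff 5

/-- The exponent vector of `xᵢᵏ`. -/
noncomputable def expSingle {n d : ℕ} (i : Fin n) (k : ℕ) (hk : k ≤ d) : ExpLE n d :=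
  ⟨Finsupp.single i k, by simpa using hk⟩

lemma not_isUDR_two_two_two {K : Type*} [Field K] (M : Matrix (Fin 2) (Fin 2) (URing K 2 2)) :
    ¬ IsUDR K 2 2 2 M := by
  rintro ⟨hspan, hdet⟩
  choose a u b w hM using fun i j => exists_substLine_eq_linePoly (hspan i j)
  let A : Matrix (Fin 2) (Fin 2) K := .of a
  let U (k : Fin 2) : Matrix (Fin 2) (Fin 2) K := .of fun i j => u i j k
  let B (β : ExpLE 2 2) : Matrix (Fin 2) (Fin 2) K := .of fun i j => b i j β
  let W (β : ExpLE 2 2) (k : Fin 2) : Matrix (Fin 2) (Fin 2) K := .of fun i j => w i j β k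
  have hline (s : Fin 2 → K) (β : ExpLE 2 2) := by
    refine coeff_det_linePoly (A := A) (U := ∑ k, s k • U k) (B := B β) (W := ∑ k, s k • W β k)
      (c := ∏ i, s i ^ β.1 i) (k := ∑ i, β.1 i) ?_
    rw [← substLine_genPoly, ← hdet, AlgHom.map_det]
    congr 1
    ext1 i j
    simp [hM, A, U, B, W, Matrix.sum_apply]
  let zeroExp : ExpLE 2 2 := expSingle 0 0 (Nat.zero_le 2)
  obtain ⟨hA, -⟩ := hline 0 zeroExp
  obtain ⟨-, hAU0, hU0, -⟩ := hline ![1, 0] zeroExp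
  obtain ⟨-, hAU1, hU1, -⟩ := hline ![0, 1] zeroExp
  obtain ⟨-, -, hU, -⟩ := hline ![1, 1] zeroExp
  simp only [Fin.sum_univ_two, Matrix.cons_val_zero, Matrix.cons_val_one, one_smul, zero_smul,
    add_zero, zero_add] at hAU0 hU0 hAU1 hU1 hU
  have hsymm (P Q : Matrix (Fin 2) (Fin 2) K) : detPolar P Q = detPolar Q P := by
    simp only [detPolar]; ring
  have hself (P : Matrix (Fin 2) (Fin 2) K) : detPolar P P = 2 * P.det := by
    simp only [detPolar, Matrix.det_fin_two]; ring
  have hsmul (c : K) (P Q : Matrix (Fin 2) (Fin 2) K) :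
      detPolar (c • P) Q = c * detPolar P Q := by
    simp only [detPolar, Matrix.smul_apply, smul_eq_mul]; ring
  have hU01 : detPolar (U 0) (U 1) = 0 := by
    have : (U 0 + U 1).det = (U 0).det + detPolar (U 0) (U 1) + (U 1).det := by
      simp only [detPolar, Matrix.det_fin_two, Matrix.add_apply]; ring
    simpa [hU, hU0, hU1] using this.symm
  obtain ⟨g, hg, hg0⟩ := exists_sum_smul_eq_zero_of_detPolar ![A, U 0, U 1] (by
    intro i j
    fin_cases i <;> fin_cases j <;>
      simp [hself, hA, hU0, hU1, hAU0, hAU1, hU01, hsymm _ A, hsymm (U 1) (U 0)])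
  have hline_g : ∑ k, ![g 1, g 2] k • U k = (-g 0) • A := by
    simp only [Fin.sum_univ_three, Matrix.cons_val_zero, Matrix.cons_val_one,
      Matrix.cons_val] at hg
    simp only [Fin.sum_univ_two, Matrix.cons_val_zero, Matrix.cons_val_one, neg_smul]
    rw [eq_neg_iff_add_eq_zero, ← hg]
    abel
  by_cases h0 : g 0 = 0
  · obtain ⟨i, hi⟩ : ∃ i : Fin 2, ![g 1, g 2] i ≠ 0 := by
      obtain ⟨i, hi⟩ := hg0
      induction i using Fin.cases with
      | zero => exact absurd h0 hi
      | succ i => exact ⟨i, by fin_cases i <;> simpa using hi⟩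
    obtain ⟨-, -, -, -, -, h5⟩ := hline ![g 1, g 2] (expSingle i 2 le_rfl)
    rw [hline_g, hsmul, h0] at h5
    refine hi ?_
    refine pow_eq_zero_iff (n := 2) two_ne_zero |>.1 ?_
    fin_cases i <;> simpa [expSingle, Fin.sum_univ_two] using h5.symm
  · obtain ⟨-, -, -, h3, h4, h5⟩ := hline ![g 1, g 2] zeroExp
    rw [hline_g, hsmul] at h4 h5
    simp [zeroExp, expSingle] at h3 h4 h5
    simp_all

/-- The exponent vector of `x₀ᵃ x₁ᵇ`. -/
noncomputable def expPair {d : ℕ} (a b : ℕ) (h : a + b ≤ d) : ExpLE 2 d :=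
  ⟨Finsupp.equivFunOnFinite.symm ![a, b], by
    simpa [Finsupp.sum_fintype, Fin.sum_univ_two] using h⟩

lemma expPair_eta {d : ℕ} (α : ExpLE 2 d) (h : α.1 0 + α.1 1 ≤ d) :
    expPair (α.1 0) (α.1 1) h = α := by
  refine Subtype.ext (Finsupp.ext fun i => ?_)
  fin_cases i <;> simp [expPair]

lemma expPair_inj {d a b a' b' : ℕ} {h : a + b ≤ d} {h' : a' + b' ≤ d} :
    expPair a b h = expPair a' b' h' ↔ a = a' ∧ b = b' := by
  refine ⟨fun he => ?_, by rintro ⟨rfl, rfl⟩; rfl⟩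
  have h0 := DFunLike.congr_fun (congrArg Subtype.val he) 0
  have h1 := DFunLike.congr_fun (congrArg Subtype.val he) 1
  exact ⟨by simpa [expPair] using h0, by simpa [expPair] using h1⟩

lemma univ_expLE_two_two : (Finset.univ : Finset (ExpLE 2 2)) =
    {expPair 0 0 (by lia), expPair 1 0 (by lia), expPair 0 1 (by lia), expPair 2 0 (by lia),
      expPair 1 1 (by lia), expPair 0 2 (by lia)} := by
  refine (Finset.eq_univ_iff_forall.2 fun α => ?_).symm
  have h : α.1 0 + α.1 1 ≤ 2 := by
    simpa [Finsupp.sum_fintype, Fin.sum_univ_two] using α.2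
  rw [← expPair_eta α h]
  simp only [Finset.mem_insert, Finset.mem_singleton, expPair_inj]
  lia

lemma exists_isUDR_two_two_three (K : Type*) [Field K] :
    ∃ M : Matrix (Fin 3) (Fin 3) (URing K 2 2), IsUDR K 2 2 3 M := by
  let c (a b : ℕ) (h : a + b ≤ 2) : URing K 2 2 := X (Sum.inr (expPair a b h))
  let x (i : Fin 2) : URing K 2 2 := X (Sum.inl i)
  have hone : (1 : URing K 2 2) ∈ Submodule.span K (allowedMonomials K 2 2) :=
    Submodule.subset_span (.inl (.inl (.inl rfl)))
  have hx (i : Fin 2) : x i ∈ Submodule.span K (allowedMonomials K 2 2) :=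
    Submodule.subset_span (.inl (.inl (.inr ⟨i, rfl⟩)))
  have hc (a b : ℕ) (h : a + b ≤ 2) : c a b h ∈ Submodule.span K (allowedMonomials K 2 2) :=
    Submodule.subset_span (.inl (.inr ⟨_, rfl⟩))
  have hcx (a b : ℕ) (h : a + b ≤ 2) (i : Fin 2) :
      c a b h * x i ∈ Submodule.span K (allowedMonomials K 2 2) :=
    Submodule.subset_span (.inr ⟨(_, i), rfl⟩)
  refine ⟨!![c 0 0 (by lia) + c 1 0 (by lia) * x 0 + c 0 1 (by lia) * x 1,
      c 2 0 (by lia) * x 0 + c 1 1 (by lia) * x 1, c 0 2 (by lia) * x 1;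
      -x 0, 1, 0; -x 1, 0, 1], fun i j => ?_, ?_⟩
  · fin_cases i <;> fin_cases j <;>
      simp [hone, hx, hc, hcx, Submodule.add_mem]
  · rw [genPoly, univ_expLE_two_two]
    simp [Matrix.det_fin_three, Finset.sum_insert, expPair_inj]
    simp [expPair, x, c]
    ring

lemma IsUDR.two_of_lt {K : Type*} [Field K] {n d N : ℕ} (hN : N < 2)
    {M : Matrix (Fin N) (Fin N) (URing K n d)} (hM : IsUDR K n d N M) :
    ∃ M' : Matrix (Fin 2) (Fin 2) (URing K n d), IsUDR K n d 2 M' := by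
  have hone : (1 : URing K n d) ∈ Submodule.span K (allowedMonomials K n d) :=
    Submodule.subset_span (.inl (.inl (.inl rfl)))
  obtain ⟨hspan, hdet⟩ := hM
  have hgen : genPoly K n d ∈ Submodule.span K (allowedMonomials K n d) := by
    rw [← hdet]
    interval_cases N
    · simpa using hone
    · simpa using hspan 0 0
  refine ⟨!![genPoly K n d, 0; 0, 1], fun i j => ?_, by simp⟩
  fin_cases i <;> fin_cases j <;> simp [hone, hgen]

/-- Proposition 6.1. `N*(2,2) = 3`: the generic bivariate quadric admits a
uniform determinantal representation of size 3, and none of size 2. -/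
theorem Nstar_two_two (K : Type*) [Field K] :
    Nstar K 2 2 = 3 ∧
    (∃ M : Matrix (Fin 3) (Fin 3) (URing K 2 2), IsUDR K 2 2 3 M) ∧
    ¬ ∃ M : Matrix (Fin 2) (Fin 2) (URing K 2 2), IsUDR K 2 2 2 M := by
  have htwo : ¬ ∃ M : Matrix (Fin 2) (Fin 2) (URing K 2 2), IsUDR K 2 2 2 M :=
    fun ⟨M, hM⟩ => not_isUDR_two_two_two M hM
  refine ⟨le_antisymm (Nat.sInf_le (exists_isUDR_two_two_three K)) ?_,
    exists_isUDR_two_two_three K, htwo⟩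
  refine le_csInf ⟨3, exists_isUDR_two_two_three K⟩ ?_
  rintro N ⟨M, hM⟩
  by_contra! hN
  obtain rfl | hN : N = 2 ∨ N < 2 := by lia
  · exact htwo ⟨M, hM⟩
  · exact htwo (hM.two_of_lt hN)
end

section
/- Let K be a field. Then N*(3,2) = 4: the generic quadric in three variables p_{3,2} admits a uniform determinantal representation of size 4, and admits no uniform determinantal representation of size 3. -/
open MvPolynomial

/-- Uniform determinantal representations can be padded with an identity block. -/
theorem IsUDR.pad {K : Type*} [Field K] {n d N : ℕ} {M : Matrix (Fin N) (Fin N) (URing K n d)}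
    (h : IsUDR K n d N M) (k : ℕ) :
    ∃ M' : Matrix (Fin (N + k)) (Fin (N + k)) (URing K n d), IsUDR K n d (N + k) M' := by
  refine ⟨Matrix.reindex finSumFinEquiv finSumFinEquiv (Matrix.fromBlocks M 0 0 1), ?_, ?_⟩
  · intro i j
    rw [Matrix.reindex_apply, Matrix.submatrix_apply]
    rcases finSumFinEquiv.symm i with i | i <;> rcases finSumFinEquiv.symm j with j | j
    · exact h.1 i j
    · exact Submodule.zero_mem _
    · exact Submodule.zero_mem _
    · rw [Matrix.fromBlocks_apply₂₂, Matrix.one_apply]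
      split_ifs
      · exact one_mem_span_allowedMonomials K n d
      · exact Submodule.zero_mem _
  · rw [Matrix.det_reindex_self, Matrix.det_fromBlocks_zero₂₁, Matrix.det_one, mul_one, h.2]

/-- The monomials `1, x₁, x₂, x₃`. -/
noncomputable def affineMonomial (K : Type*) [Field K] (d : ℕ) : Fin 4 → URing K 3 d :=
  ![1, X (Sum.inl 0), X (Sum.inl 1), X (Sum.inl 2)]

theorem exists_affineMonomial_mul (K : Type*) [Field K] (α : ExpLE 3 2) :
    ∃ k r : Fin 4, ∏ i : Fin 3, (X (Sum.inl i) : URing K 3 2) ^ (α.1 i) =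
      affineMonomial K 2 k * affineMonomial K 2 r := by
  obtain ⟨α, hα⟩ := α
  rw [Finsupp.sum_fintype _ _ (fun _ => rfl), Fin.sum_univ_three] at hα
  have exponents : ∀ a b c : Fin 3, a.1 + b.1 + c.1 ≤ 2 → ∃ k r : Fin 4,
      a.1 = ![0, 1, 0, 0] k + ![0, 1, 0, 0] r ∧ b.1 = ![0, 0, 1, 0] k + ![0, 0, 1, 0] r ∧
        c.1 = ![0, 0, 0, 1] k + ![0, 0, 0, 1] r := by decide
  obtain ⟨k, r, h0, h1, h2⟩ := exponents ⟨α 0, by lia⟩ ⟨α 1, by lia⟩ ⟨α 2, by lia⟩ hα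
  have hm : ∀ k : Fin 4, affineMonomial K 2 k = X (Sum.inl 0) ^ (![0, 1, 0, 0] k) *
      X (Sum.inl 1) ^ (![0, 0, 1, 0] k) * X (Sum.inl 2) ^ (![0, 0, 0, 1] k) := by
    intro k
    fin_cases k <;> simp [affineMonomial]
  refine ⟨k, r, ?_⟩
  rw [Fin.prod_univ_three, hm k, hm r]
  dsimp only at h0 h1 h2 ⊢
  rw [h0, h1, h2]
  ring

theorem exists_isUDR_three_two (K : Type*) [Field K] :
    ∃ M : Matrix (Fin 4) (Fin 4) (URing K 3 2), IsUDR K 3 2 4 M := by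
  choose k r hkr using exists_affineMonomial_mul K
  have hx : ∀ i : Fin 3, (X (Sum.inl i) : URing K 3 2) ∈
      Submodule.span K (allowedMonomials K 3 2) :=
    fun i => Submodule.subset_span (by simp [allowedMonomials])
  have hc : ∀ (α : ExpLE 3 2) (j : Fin 4), X (Sum.inr α) * affineMonomial K 2 j ∈
      Submodule.span K (allowedMonomials K 3 2) := by
    intro α j
    refine Submodule.subset_span ?_
    fin_cases j
    · exact Or.inl (Or.inr ⟨α, (mul_one _).symm⟩)
    · exact Or.inr ⟨(α, 0), rfl⟩
    · exact Or.inr ⟨(α, 1), rfl⟩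
    · exact Or.inr ⟨(α, 2), rfl⟩
  let l : Fin 4 → URing K 3 2 := fun j =>
    ∑ α : ExpLE 3 2, if k α = j then X (Sum.inr α) * affineMonomial K 2 (r α) else 0
  have hl : ∀ j, l j ∈ Submodule.span K (allowedMonomials K 3 2) := by
    intro j
    refine Submodule.sum_mem _ fun α _ => ?_
    split_ifs
    · exact hc α (r α)
    · exact Submodule.zero_mem _
  have hgen : genPoly K 3 2 = ∑ j, l j * affineMonomial K 2 j := by
    simp only [genPoly, l, Finset.sum_mul, ite_mul, zero_mul]
    rw [Finset.sum_comm]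
    refine Finset.sum_congr rfl fun α _ => ?_
    rw [Finset.sum_ite_eq, if_pos (Finset.mem_univ _), hkr]
    ring
  refine ⟨!![l 0, l 1, l 2, l 3; -X (Sum.inl 0), 1, 0, 0; -X (Sum.inl 1), 0, 1, 0;
    -X (Sum.inl 2), 0, 0, 1], ?_, ?_⟩
  · intro i j
    have h1 := one_mem_span_allowedMonomials K 3 2
    have h0 := Submodule.zero_mem (Submodule.span K (allowedMonomials K 3 2))
    fin_cases i <;> fin_cases j <;>
      first
      | exact hl _
      | exact h1
      | exact h0
      | exact Submodule.neg_mem _ (hx _)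
  · rw [hgen, Fin.sum_univ_four]
    simp [Matrix.det_succ_row_zero, Fin.sum_univ_succ, Fin.succAbove, affineMonomial]
    ring

/-- The matrix pencil `A + X B`. -/
noncomputable def matrixPencil {R : Type*} [CommRing R] {N : ℕ}
    (A B : Matrix (Fin N) (Fin N) R) : Matrix (Fin N) (Fin N) (Polynomial R) :=
  Matrix.of fun i j => Polynomial.C (A i j) + Polynomial.X * Polynomial.C (B i j)

theorem map_C_mul_matrixPencil_mul_map_C {R : Type*} [CommRing R] {N : ℕ}
    (P A B Q : Matrix (Fin N) (Fin N) R) :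
    P.map Polynomial.C * matrixPencil A B * Q.map Polynomial.C =
      matrixPencil (P * A * Q) (P * B * Q) := by
  ext1 i j
  simp only [Matrix.mul_apply, matrixPencil, Matrix.of_apply, Matrix.map_apply, map_sum,
    Polynomial.C_mul, Finset.mul_sum, Finset.sum_mul, ← Finset.sum_add_distrib]
  refine Finset.sum_congr rfl fun _ _ => Finset.sum_congr rfl fun _ _ => ?_
  ring

theorem det_matrixPencil_three {R : Type*} [CommRing R] (A B : Matrix (Fin 3) (Fin 3) R) :
    (matrixPencil A B).det = Polynomial.C A.det +
      Polynomial.X * Polynomial.C (A.adjugate * B).trace +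
      Polynomial.X ^ 2 * Polynomial.C (A * B.adjugate).trace +
      Polynomial.X ^ 3 * Polynomial.C B.det := by
  simp only [matrixPencil, Matrix.det_fin_three, Matrix.adjugate_fin_three,
    Matrix.trace_fin_three, Matrix.mul_apply, Fin.sum_univ_three, Matrix.of_apply,
    Matrix.cons_val, map_add, map_sub, map_mul, map_neg]
  ring

theorem coeff_det_matrixPencil_three {R : Type*} [CommRing R] (A B : Matrix (Fin 3) (Fin 3) R) :
    (matrixPencil A B).det.coeff 0 = A.det ∧
    (matrixPencil A B).det.coeff 1 = (A.adjugate * B).trace ∧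
    (matrixPencil A B).det.coeff 2 = (A * B.adjugate).trace := by
  rw [det_matrixPencil_three]
  simp [Polynomial.coeff_X, Polynomial.coeff_X_pow]

/-- A totally singular subspace for the split quadratic form in four variables has dimension
at most two. -/
theorem exists_common_zero_of_mul_add_mul_eq_zero {K : Type*} [Field K]
    (b₀ b₁ c₀ c₁ : (Fin 3 → K) →ₗ[K] K)
    (h : ∀ p, b₀ p * c₀ p + b₁ p * c₁ p = 0) :
    ∃ p ≠ 0, b₀ p = 0 ∧ b₁ p = 0 ∧ c₀ p = 0 ∧ c₁ p = 0 := by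
  by_contra! hne
  let D := LinearMap.toMatrix' (LinearMap.pi ![b₀, b₁, c₀, c₁])
  let E := LinearMap.toMatrix' (LinearMap.pi ![c₀, c₁, b₀, b₁])
  have hED : E.transpose * D = 0 := by
    ext i j
    have hi := h (Pi.single i 1)
    have hj := h (Pi.single j 1)
    have hij := h (Pi.single i 1 + Pi.single j 1)
    simp only [map_add] at hij
    simp only [Matrix.mul_apply, Fin.sum_univ_four, Matrix.transpose_apply,
      LinearMap.toMatrix'_apply, LinearMap.pi_apply, Matrix.cons_val, Matrix.zero_apply, D, E]
    linear_combination hij - hi - hj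
  have rank_eq : ∀ f : (Fin 3 → K) →ₗ[K] (Fin 4 → K), Function.Injective f →
      (LinearMap.toMatrix' f).rank = 3 := by
    intro f hf
    rw [Matrix.rank, ← Matrix.toLin'_apply', Matrix.toLin'_toMatrix',
      LinearMap.finrank_range_of_inj hf, Module.finrank_fin_fun]
  have hD : D.rank = 3 := by
    refine rank_eq _ ((injective_iff_map_eq_zero _).2 fun p hp => ?_)
    by_contra h0
    exact hne p h0 (congrFun hp 0) (congrFun hp 1) (congrFun hp 2) (congrFun hp 3)
  have hE : E.rank = 3 := by
    refine rank_eq _ ((injective_iff_map_eq_zero _).2 fun p hp => ?_)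
    by_contra h0
    exact hne p h0 (congrFun hp 2) (congrFun hp 3) (congrFun hp 0) (congrFun hp 1)
  have := Matrix.rank_add_rank_le_card_of_mul_eq_zero hED
  rw [Matrix.rank_transpose, hD, hE, Fintype.card_fin] at this
  lia

/-- The normal form of a `3 × 3` matrix of rank two. -/
theorem exists_mul_mul_eq_diagonal {K : Type*} [Field K] {A E : Matrix (Fin 3) (Fin 3) K}
    (hA : A.det = 0) (hE : (A.adjugate * E).trace ≠ 0) :
    ∃ P Q : Matrix (Fin 3) (Fin 3) K, P.det ≠ 0 ∧ Q.det ≠ 0 ∧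
      P * A * Q = Matrix.diagonal ![1, 1, 0] := by
  obtain ⟨l, l', D, hD⟩ :=
    Matrix.Pivot.exists_list_transvec_mul_mul_list_transvec_eq_diagonal A
  set P := (l.map Matrix.TransvectionStruct.toMatrix).prod
  set Q := (l'.map Matrix.TransvectionStruct.toMatrix).prod
  have hP : P.det = 1 := Matrix.TransvectionStruct.det_toMatrix_prod l
  have hQ : Q.det = 1 := Matrix.TransvectionStruct.det_toMatrix_prod l'
  obtain ⟨k, hk⟩ : ∃ k, D k = 0 := by
    have hdet := congrArg Matrix.det hD
    rw [Matrix.det_mul, Matrix.det_mul, hA, mul_zero, zero_mul, Matrix.det_diagonal] at hdet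
    simpa using Finset.prod_eq_zero_iff.1 hdet.symm
  let σ : Equiv.Perm (Fin 3) := Equiv.swap 2 k
  have hne : ∀ i j, i ≠ j → D i = 0 → D j ≠ 0 := by
    intro i j hij hi hj
    have h0 : (Matrix.diagonal D).adjugate = 0 := by
      rw [Matrix.adjugate_diagonal, Matrix.diagonal_eq_zero]
      ext m
      obtain rfl | hm := eq_or_ne i m
      · exact Finset.prod_eq_zero (Finset.mem_erase.2 ⟨hij.symm, Finset.mem_univ j⟩) hj
      · exact Finset.prod_eq_zero (Finset.mem_erase.2 ⟨hm, Finset.mem_univ i⟩) hi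
    have hadj : A.adjugate = Q * (Matrix.diagonal D).adjugate * P := by
      rw [← hD, Matrix.adjugate_mul_distrib, Matrix.adjugate_mul_distrib, ← Matrix.mul_assoc,
        ← Matrix.mul_assoc, Matrix.mul_adjugate, Matrix.mul_assoc, Matrix.adjugate_mul, hP, hQ]
      simp
    exact hE (by simp [hadj, h0])
  have hσ : D (σ 2) = 0 := by simpa [σ] using hk
  have h0 : D (σ 0) ≠ 0 := hne _ _ (σ.injective.ne (by decide)) hσ
  have h1 : D (σ 1) ≠ 0 := hne _ _ (σ.injective.ne (by decide)) hσ
  have hsign : ((Equiv.Perm.sign σ : ℤ) : K) ≠ 0 := by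
    rcases Int.units_eq_one_or (Equiv.Perm.sign σ) with h | h <;> simp [h]
  refine ⟨Matrix.diagonal ![(D (σ 0))⁻¹, (D (σ 1))⁻¹, 1] * P.submatrix σ id,
    Q.submatrix id σ, ?_, ?_, ?_⟩
  · rw [Matrix.det_mul, Matrix.det_permute, hP, Matrix.det_diagonal, Fin.prod_univ_three]
    simp [h0, h1, hsign]
  · rw [Matrix.det_permute', hQ]
    simp [hsign]
  · have hsub : P.submatrix σ id * A * Q.submatrix id σ = Matrix.diagonal (D ∘ σ) := by
      rw [← Matrix.submatrix_diagonal_equiv, ← hD]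
      rfl
    rw [Matrix.mul_assoc, Matrix.mul_assoc, ← Matrix.mul_assoc (P.submatrix σ id), hsub,
      Matrix.diagonal_mul_diagonal]
    congr 1
    ext i
    fin_cases i <;> simp [h0, h1, hσ]

/-- If the `3 × 3` pencils `diag(1, 1, 0) + s L(p)` are all singular, then they all have the same
left and right kernels along some line through the origin. -/
theorem exists_lastRow_lastCol_eq_zero {K : Type*} [Field K]
    (L : (Fin 3 → K) →ₗ[K] Matrix (Fin 3) (Fin 3) K)
    (h : ∀ p, (matrixPencil (Matrix.diagonal ![1, 1, 0]) (L p)).det = 0) :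
    ∃ p ≠ 0, (∀ i, L p i 2 = 0) ∧ ∀ j, L p 2 j = 0 := by
  have hd : ∀ p, L p 2 2 = 0 := by
    intro p
    have h1 := (coeff_det_matrixPencil_three (Matrix.diagonal ![1, 1, 0]) (L p)).2.1
    rw [h p] at h1
    simp only [Matrix.trace_fin_three, Matrix.mul_apply, Fin.sum_univ_three,
      Matrix.adjugate_fin_three] at h1
    simpa using h1.symm
  have hbc : ∀ p, L p 0 2 * L p 2 0 + L p 1 2 * L p 2 1 = 0 := by
    intro p
    have h2 := (coeff_det_matrixPencil_three (Matrix.diagonal ![1, 1, 0]) (L p)).2.2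
    rw [h p] at h2
    simp [Matrix.adjugate_fin_three, Matrix.trace_fin_three, Matrix.mul_apply,
      Fin.sum_univ_three, hd p] at h2
    linear_combination h2
  let e : Fin 3 → Fin 3 → (Fin 3 → K) →ₗ[K] K := fun i j => Matrix.entryLinearMap K K i j ∘ₗ L
  obtain ⟨p, hp, h02, h12, h20, h21⟩ :=
    exists_common_zero_of_mul_add_mul_eq_zero (e 0 2) (e 1 2) (e 2 0) (e 2 1) hbc
  refine ⟨p, hp, fun i => ?_, fun j => ?_⟩
  · fin_cases i
    exacts [h02, h12, hd p]
  · fin_cases j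
    exacts [h20, h21, hd p]

theorem mul_affine_ne_of_mul_affine_eq_C {K : Type*} [Field K] {h : Polynomial K}
    {δ κ e e' f f' : K}
    (hδ : δ ≠ 0) (hκ : κ ≠ 0)
    (he : h * (Polynomial.C e + Polynomial.X * Polynomial.C e') = Polynomial.C δ) :
    h * (Polynomial.C f + Polynomial.X * Polynomial.C f') ≠
      Polynomial.C κ * Polynomial.X ^ 2 := by
  intro hf
  have hunit : IsUnit h :=
    isUnit_of_mul_isUnit_left (he ▸ Polynomial.isUnit_C.2 (isUnit_iff_ne_zero.2 hδ))
  obtain ⟨c, -, rfl⟩ := Polynomial.isUnit_iff.1 hunit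
  have := congrArg (fun q => Polynomial.coeff q 2) hf
  simp [mul_add] at this
  exact hκ this.symm

/-- The coefficients of an affine family of `3 × 3` matrices cannot represent both the constant
`δ` and all the squares `δ xᵢ²` to first order. -/
theorem det_matrixPencil_diagonal_contradiction {K : Type*} [Field K] {δ : K} (hδ : δ ≠ 0)
    (L : (Fin 3 → K) →ₗ[K] Matrix (Fin 3) (Fin 3) K)
    (E : Matrix (Fin 3) (Fin 3) K) (E' : (Fin 3 → K) → Matrix (Fin 3) (Fin 3) K)
    (F : Fin 3 → Matrix (Fin 3) (Fin 3) K) (F' : Fin 3 → (Fin 3 → K) → Matrix (Fin 3) (Fin 3) K)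
    (hE : ∀ p, (matrixPencil (matrixPencil (Matrix.diagonal ![1, 1, 0]) (L p))
      (matrixPencil E (E' p))).det = Polynomial.X * Polynomial.C (Polynomial.C δ))
    (hF : ∀ i p, (matrixPencil (matrixPencil (Matrix.diagonal ![1, 1, 0]) (L p))
      (matrixPencil (F i) (F' i p))).det =
        Polynomial.X * Polynomial.C (Polynomial.C (δ * p i ^ 2) * Polynomial.X ^ 2)) : False := by
  obtain ⟨p, hp, hcol, hrow⟩ := exists_lastRow_lastCol_eq_zero L fun p => by
    rw [← (coeff_det_matrixPencil_three _ (matrixPencil E (E' p))).1, hE]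
    simp
  obtain ⟨i, hi⟩ := Function.ne_iff.1 hp
  let A := matrixPencil (Matrix.diagonal ![1, 1, 0]) (L p)
  have hA : ∀ B : Matrix (Fin 3) (Fin 3) (Polynomial K),
      (A.adjugate * B).trace = (A 0 0 * A 1 1 - A 0 1 * A 1 0) * B 2 2 := by
    intro B
    have hA0 : ∀ i, A i 2 = 0 := by
      intro i
      fin_cases i <;> simp [A, matrixPencil, hcol]
    have hA1 : ∀ j, A 2 j = 0 := by
      intro j
      fin_cases j <;> simp [A, matrixPencil, hrow]
    simp only [Matrix.trace_fin_three, Matrix.mul_apply, Fin.sum_univ_three,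
      Matrix.adjugate_fin_three]
    simp [hA0, hA1]
  have h1 := (coeff_det_matrixPencil_three A (matrixPencil E (E' p))).2.1
  have h2 := (coeff_det_matrixPencil_three A (matrixPencil (F i) (F' i p))).2.1
  rw [hE, hA] at h1
  rw [hF, hA] at h2
  simp only [Polynomial.coeff_X_mul, Polynomial.coeff_C_zero] at h1 h2
  exact mul_affine_ne_of_mul_affine_eq_C hδ (mul_ne_zero hδ (pow_ne_zero 2 hi)) h1.symm h2.symm

theorem det_matrixPencil_contradiction {K : Type*} [Field K] (A : Matrix (Fin 3) (Fin 3) K)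
    (L : (Fin 3 → K) →ₗ[K] Matrix (Fin 3) (Fin 3) K)
    (E : Matrix (Fin 3) (Fin 3) K) (E' : (Fin 3 → K) → Matrix (Fin 3) (Fin 3) K)
    (F : Fin 3 → Matrix (Fin 3) (Fin 3) K) (F' : Fin 3 → (Fin 3 → K) → Matrix (Fin 3) (Fin 3) K)
    (hE : ∀ p, (matrixPencil (matrixPencil A (L p)) (matrixPencil E (E' p))).det =
      Polynomial.X)
    (hF : ∀ i p, (matrixPencil (matrixPencil A (L p)) (matrixPencil (F i) (F' i p))).det =
        Polynomial.X * Polynomial.C (Polynomial.C (p i ^ 2) * Polynomial.X ^ 2)) : False := by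
  have h0 := (coeff_det_matrixPencil_three (matrixPencil A (L 0)) (matrixPencil E (E' 0))).1
  have h1 := (coeff_det_matrixPencil_three (matrixPencil A (L 0)) (matrixPencil E (E' 0))).2.1
  rw [hE] at h0 h1
  have hmap : ∀ B B' : Matrix (Fin 3) (Fin 3) K,
      (Polynomial.evalRingHom 0).mapMatrix (matrixPencil B B') = B := by
    intro B B'
    ext i j
    simp [matrixPencil]
  have hdet : A.det = 0 := by
    have := congrArg (Polynomial.evalRingHom 0) h0
    rw [RingHom.map_det, hmap] at this
    simpa using this.symm
  have htr : (A.adjugate * E).trace ≠ 0 := by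
    have := congrArg (Polynomial.evalRingHom 0) h1
    rw [AddMonoidHom.map_trace, ← RingHom.mapMatrix_apply, map_mul, RingHom.map_adjugate,
      hmap, hmap] at this
    simp [← this]
  obtain ⟨P, Q, hP, hQ, hPQ⟩ := exists_mul_mul_eq_diagonal hdet htr
  have key : ∀ B B' G G' : Matrix (Fin 3) (Fin 3) K,
      (matrixPencil (matrixPencil (P * B * Q) (P * B' * Q))
        (matrixPencil (P * G * Q) (P * G' * Q))).det =
      Polynomial.C (Polynomial.C (P.det * Q.det)) *
        (matrixPencil (matrixPencil B B') (matrixPencil G G')).det := by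
    intro B B' G G'
    have hC : ∀ (S : Type _) [CommRing S] (N : Matrix (Fin 3) (Fin 3) S),
        (N.map Polynomial.C).det = Polynomial.C N.det :=
      fun S _ N => (RingHom.map_det Polynomial.C N).symm
    rw [← map_C_mul_matrixPencil_mul_map_C, ← map_C_mul_matrixPencil_mul_map_C,
      ← map_C_mul_matrixPencil_mul_map_C, Matrix.det_mul, Matrix.det_mul, hC, hC, hC, hC,
      Polynomial.C_mul, Polynomial.C_mul]
    ring
  refine det_matrixPencil_diagonal_contradiction (mul_ne_zero hP hQ)
    ((LinearMap.mulLeft K P ∘ₗ LinearMap.mulRight K Q) ∘ₗ L)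
    (P * E * Q) (fun p => P * E' p * Q) (fun i => P * F i * Q) (fun i p => P * F' i p * Q)
    (fun p => ?_) (fun i p => ?_)
  · rw [← hPQ, LinearMap.comp_apply, LinearMap.comp_apply, LinearMap.mulRight_apply,
      LinearMap.mulLeft_apply, ← Matrix.mul_assoc, key, hE]
    ring
  · rw [← hPQ, LinearMap.comp_apply, LinearMap.comp_apply, LinearMap.mulRight_apply,
      LinearMap.mulLeft_apply, ← Matrix.mul_assoc, key, hF]
    simp only [Polynomial.C_mul]
    ring

/-- Substitute `s p` for `x` and `ε` for `c_α`, and set the other `c_β` to zero. -/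
noncomputable def lineSpecialization {K : Type*} [Field K] {n d : ℕ} (α : ExpLE n d)
    (p : Fin n → K) : URing K n d →ₐ[K] Polynomial (Polynomial K) :=
  aeval (Sum.elim (fun i => Polynomial.C (Polynomial.X * Polynomial.C (p i)))
    fun β => if β = α then Polynomial.X else 0)

theorem lineSpecialization_genPoly {K : Type*} [Field K] {n d : ℕ} (α : ExpLE n d)
    (p : Fin n → K) : lineSpecialization α p (genPoly K n d) = Polynomial.X *
      Polynomial.C (∏ i, (Polynomial.X * Polynomial.C (p i)) ^ (α.1 i)) := by
  simp [genPoly, lineSpecialization]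

theorem lineSpecialization_of_mem_span {K : Type*} [Field K] {n d : ℕ} {m : URing K n d}
    (hm : m ∈ Submodule.span K (allowedMonomials K n d)) :
    ∃ (a : K) (l : (Fin n → K) →ₗ[K] K) (e : ExpLE n d → K)
      (e' : ExpLE n d → (Fin n → K) → K), ∀ α p, lineSpecialization α p m =
        Polynomial.C (Polynomial.C a + Polynomial.X * Polynomial.C (l p)) +
        Polynomial.X * Polynomial.C (Polynomial.C (e α) +
          Polynomial.X * Polynomial.C (e' α p)) := by
  induction hm using Submodule.span_induction with
  | mem m hm =>
    rcases hm with ((rfl | ⟨i, rfl⟩) | ⟨β, rfl⟩) | ⟨⟨β, i⟩, rfl⟩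
    · exact ⟨1, 0, 0, 0, fun α p => by simp⟩
    · exact ⟨0, LinearMap.proj i, 0, 0, fun α p => by simp [lineSpecialization]⟩
    · refine ⟨0, 0, fun α => if β = α then 1 else 0, 0, fun α p => ?_⟩
      by_cases h : β = α <;> simp [lineSpecialization, h]
    · refine ⟨0, 0, 0, fun α p => if β = α then p i else 0, fun α p => ?_⟩
      by_cases h : β = α <;> simp [lineSpecialization, h]
  | zero => exact ⟨0, 0, 0, 0, fun α p => by simp⟩
  | add x y _ _ hx hy =>
    obtain ⟨a, l, e, e', hx⟩ := hx
    obtain ⟨b, k, f, f', hy⟩ := hy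
    refine ⟨a + b, l + k, e + f, e' + f', fun α p => ?_⟩
    simp only [map_add, hx, hy, LinearMap.add_apply, Pi.add_apply, mul_add]
    ring
  | smul c x _ hx =>
    obtain ⟨a, l, e, e', hx⟩ := hx
    refine ⟨c * a, c • l, c • e, c • e', fun α p => ?_⟩
    rw [map_smul, hx, Algebra.smul_def, IsScalarTower.algebraMap_apply K (Polynomial K),
      Polynomial.algebraMap_eq, Polynomial.algebraMap_eq]
    simp only [map_add, map_mul, LinearMap.smul_apply, Pi.smul_apply, smul_eq_mul]
    ring

theorem not_isUDR_three_two_three (K : Type*) [Field K]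
    (M : Matrix (Fin 3) (Fin 3) (URing K 3 2)) : ¬ IsUDR K 3 2 3 M := by
  rintro ⟨hspan, hdet⟩
  choose a l e e' h using fun i j => lineSpecialization_of_mem_span (hspan i j)
  let L : (Fin 3 → K) →ₗ[K] Matrix (Fin 3) (Fin 3) K :=
    { toFun := fun p => Matrix.of fun i j => l i j p
      map_add' := fun p q => by ext; simp
      map_smul' := fun c p => by ext; simp }
  let E : ExpLE 3 2 → Matrix (Fin 3) (Fin 3) K := fun α => Matrix.of fun i j => e i j α
  let E' : ExpLE 3 2 → (Fin 3 → K) → Matrix (Fin 3) (Fin 3) K :=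
    fun α p => Matrix.of fun i j => e' i j α p
  have hM : ∀ α p, (matrixPencil (matrixPencil (Matrix.of a) (L p))
      (matrixPencil (E α) (E' α p))).det =
        Polynomial.X * Polynomial.C (∏ i, (Polynomial.X * Polynomial.C (p i)) ^ (α.1 i)) := by
    intro α p
    rw [← lineSpecialization_genPoly, ← hdet, AlgHom.map_det]
    congr 1
    ext1 i j
    exact (h i j α p).symm
  let α₀ : ExpLE 3 2 := ⟨0, by simp⟩
  let α₂ : Fin 3 → ExpLE 3 2 := fun i => ⟨Finsupp.single i 2, by simp⟩
  refine det_matrixPencil_contradiction (Matrix.of a) L (E α₀) (E' α₀) (fun i => E (α₂ i))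
    (fun i => E' (α₂ i)) (fun p => ?_) (fun i p => ?_)
  · rw [hM]
    simp [α₀]
  · rw [hM, Finset.prod_eq_single i (fun j _ hj => by simp [α₂, hj.symm]) (by simp)]
    simp only [α₂, Finsupp.single_eq_same, mul_pow, Polynomial.C_pow, Polynomial.C_mul]
    ring

/-- Proposition 6.2. `N*(3,2) = 4`: the generic quadric in three variables
admits a uniform determinantal representation of size 4, and none of size 3. -/
theorem Nstar_three_two (K : Type*) [Field K] :
    Nstar K 3 2 = 4 ∧
    (∃ M : Matrix (Fin 4) (Fin 4) (URing K 3 2), IsUDR K 3 2 4 M) ∧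
    ¬ ∃ M : Matrix (Fin 3) (Fin 3) (URing K 3 2), IsUDR K 3 2 3 M := by
  refine ⟨le_antisymm (Nat.sInf_le (exists_isUDR_three_two K)) ?_, exists_isUDR_three_two K,
    fun ⟨M, hM⟩ => not_isUDR_three_two_three K M hM⟩
  refine le_csInf ⟨4, exists_isUDR_three_two K⟩ ?_
  rintro N ⟨M, hM⟩
  by_contra! hN
  obtain ⟨k, hk⟩ := Nat.exists_eq_add_of_le (Nat.le_of_lt_succ hN)
  have hpad := hM.pad k
  rw [← hk] at hpad
  obtain ⟨M', hM'⟩ := hpad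
  exact not_isUDR_three_two_three K M' hM'
end

section
/- Let K be a field and n ≥ 1 an integer, and set m := ⌊n/3⌋. Then N*(n,4) ≤ 3n + 1 + m·n − 3m(m+1)/2. (The construction takes V spanned by 1, x_1,…,x_n, x_1²,…,x_n², and W spanned by 1, x_1,…,x_n together with the pairs x_αx_β where α, β lie in the same block of a partition of {1,…,n} into three nearly equal groups; these pairs form a Turán (n,4,2)-system of size m·n − 3m(m+1)/2, every 4-subset of {1,…,n} containing at least one such pair, whence F_1·V·W ⊇ F_4.) In particular N*(n,4) ≤ n²/6 + O(n). -/
open MvPolynomial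

namespace UniformDet

open Matrix

section Determinants

variable {R : Type*} [CommRing R]

theorem det_fromBlocks_neg_mul {m n : Type*} [Fintype m] [Fintype n] [DecidableEq m]
    [DecidableEq n] (A : Matrix m m R) (B : Matrix m n R) (C : Matrix n m R) (D : Matrix n n R) :
    (fromBlocks A B (-(D * C)) D).det = (A + B * C).det * D.det := by
  have h : fromBlocks A B (-(D * C)) D * fromBlocks 1 0 C 1 = fromBlocks (A + B * C) B 0 D := by
    simp [fromBlocks_multiply]
  simpa using congrArg det h

theorem det_fromBlocks_neg_mul' {m n : Type*} [Fintype m] [Fintype n] [DecidableEq m]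
    [DecidableEq n] (A : Matrix m m R) (B : Matrix m n R) (C : Matrix n m R) (D : Matrix n n R) :
    (fromBlocks A (-(B * D)) C D).det = (A + B * C).det * D.det := by
  have h : fromBlocks 1 B 0 1 * fromBlocks A (-(B * D)) C D = fromBlocks (A + B * C) 0 C D := by
    simp [fromBlocks_multiply]
  simpa using congrArg det h

/-- The bordered matrix which carries the coefficient block `L` and the relation blocks
`(b | A)` of two families of monomials. -/
def bordered {I J : Type*} (L : Matrix (Unit ⊕ I) (Unit ⊕ J) R) (b : Matrix Unit I R)
    (A : Matrix I I R) (b' : Matrix J Unit R) (A' : Matrix J J R) :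
    Matrix ((Unit ⊕ I) ⊕ J) ((Unit ⊕ I) ⊕ J) R :=
  fromBlocks (fromBlocks L.toBlocks₁₁ b L.toBlocks₂₁ A) (of fun a j => L a (Sum.inr j))
    (fromCols b' 0) A'

theorem bordered_mem {I J : Type*} (S : AddSubgroup R) {L : Matrix (Unit ⊕ I) (Unit ⊕ J) R}
    {b : Matrix Unit I R} {A : Matrix I I R} {b' : Matrix J Unit R} {A' : Matrix J J R}
    (hL : ∀ i j, L i j ∈ S) (hb : ∀ i j, b i j ∈ S) (hA : ∀ i j, A i j ∈ S)
    (hb' : ∀ i j, b' i j ∈ S) (hA' : ∀ i j, A' i j ∈ S) (i j : (Unit ⊕ I) ⊕ J) :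
    bordered L b A b' A' i j ∈ S := by
  rcases i with (i | i) | i <;> rcases j with (j | j) | j <;>
    simp [bordered, toBlocks₁₁, toBlocks₂₁, hL, hb, hA, hb', hA', S.zero_mem]

theorem det_bordered {I J : Type*} [Fintype I] [Fintype J] [DecidableEq I] [DecidableEq J]
    (L : Matrix (Unit ⊕ I) (Unit ⊕ J) R) (w : I → R) (A : Matrix I I R)
    (v : J → R) (A' : Matrix J J R) (hA : A.det = 1) (hA' : A'.det = 1) :
    (bordered L (-(replicateRow Unit w * A)) A (-(A' * replicateCol Unit v)) A').det =
      ∑ a, ∑ b, Sum.elim (fun _ => 1) w a * L a b * Sum.elim (fun _ => 1) v b := by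
  have h : fromCols (-(A' * replicateCol Unit v)) (0 : Matrix J I R) =
      -(A' * fromCols (replicateCol Unit v) 0) := by
    ext i (j | j) <;> simp [mul_apply]
  have h' : fromBlocks L.toBlocks₁₁ (-(replicateRow Unit w * A)) L.toBlocks₂₁ A +
      (of fun a j => L a (Sum.inr j)) * fromCols (replicateCol Unit v) 0 =
      fromBlocks (L.toBlocks₁₁ + L.toBlocks₁₂ * replicateCol Unit v) (-(replicateRow Unit w * A))
        (L.toBlocks₂₁ + L.toBlocks₂₂ * replicateCol Unit v) A := by
    ext (i | i) (j | j) <;> simp [mul_apply, toBlocks₁₁, toBlocks₁₂, toBlocks₂₁, toBlocks₂₂]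
  rw [bordered, h, det_fromBlocks_neg_mul, h', det_fromBlocks_neg_mul', hA, hA', det_unique]
  simp [mul_apply, toBlocks₁₁, toBlocks₁₂, toBlocks₂₁, toBlocks₂₂, Finset.mul_sum, mul_add,
    mul_assoc]

end Determinants

section Turan

/-- The pairs `i < j` in `Fin n` with `i ≡ j` modulo `3`, where `i = j % 3 + 3 * k`. -/
abbrev BlockPair (n : ℕ) : Type := Σ j : Fin n, Fin (j.1 / 3)

/-- The smaller element of a pair. -/
def BlockPair.lower {n : ℕ} (s : BlockPair n) : Fin n :=
  ⟨s.1.1 % 3 + 3 * s.2.1, by have := s.1.2; have := s.2.2; omega⟩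

theorem BlockPair.exists_of_lt {n : ℕ} {a b : Fin n} (h : a < b) (hab : a.1 % 3 = b.1 % 3) :
    ∃ s : BlockPair n, s.lower = a ∧ s.1 = b := by
  have h' : a.1 < b.1 := h
  exact ⟨⟨b, ⟨a.1 / 3, by omega⟩⟩, Fin.ext (by simp only [BlockPair.lower]; omega), rfl⟩

theorem two_mul_sum_div_three (n : ℕ) :
    2 * ∑ j ∈ Finset.range n, j / 3 + 3 * (n / 3 * (n / 3 + 1)) = 2 * (n / 3 * n) := by
  induction n with
  | zero => simp
  | succ n ih =>
    rw [Finset.sum_range_succ]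
    obtain ⟨m, r, hr, rfl⟩ : ∃ m r, r < 3 ∧ n = 3 * m + r :=
      ⟨n / 3, n % 3, Nat.mod_lt _ (by norm_num), by omega⟩
    have h : (3 * m + r) / 3 = m := by omega
    rw [h] at ih ⊢
    by_cases h2 : r = 2
    · subst h2
      have h' : (3 * m + 2 + 1) / 3 = m + 1 := by omega
      rw [h']
      linarith
    · have h' : (3 * m + r + 1) / 3 = m := by omega
      rw [h']
      linarith

theorem card_blockPair (n : ℕ) :
    Fintype.card (BlockPair n) = n / 3 * n - 3 * (n / 3 * (n / 3 + 1)) / 2 := by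
  have h := two_mul_sum_div_three n
  rw [Fintype.card_sigma]
  simp only [Fintype.card_fin]
  rw [Fin.sum_univ_eq_sum_range (fun j => j / 3) n]
  omega

end Turan

section Factorization

variable {R : Type*} [CommRing R] {n : ℕ} (x : Fin n → R)

/-- The monomials `xᵢ` and `xᵢ²`. -/
def squareFamily : Fin n ⊕ Fin n → R := Sum.elim x fun i => x i * x i

/-- The monomials `xᵢ` and `xᵢ xⱼ` with `i, j` in a common block. -/
def pairFamily : Fin n ⊕ BlockPair n → R := Sum.elim x fun s => x s.lower * x s.1

/-- The relations satisfied by `squareFamily`. -/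
def squareRel : Matrix (Fin n ⊕ Fin n) (Fin n ⊕ Fin n) R := fromBlocks 1 0 (-diagonal x) 1

/-- The relations satisfied by `pairFamily`. -/
def pairRel : Matrix (Fin n ⊕ BlockPair n) (Fin n ⊕ BlockPair n) R :=
  fromBlocks 1 (of fun i s => if i = s.lower then -x s.1 else 0) 0 1

theorem det_squareRel : (squareRel x).det = 1 := by simp [squareRel]

theorem det_pairRel : (pairRel x).det = 1 := by
  classical
  simp [pairRel]

theorem one_apply_mem {ι : Type*} [DecidableEq ι] {S : AddSubgroup R} (h1 : 1 ∈ S) (i j : ι) :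
    (1 : Matrix ι ι R) i j ∈ S := by
  rw [one_apply]
  split_ifs
  exacts [h1, S.zero_mem]

theorem squareRel_mem {S : AddSubgroup R} (h1 : 1 ∈ S) (hx : ∀ i, x i ∈ S)
    (i j : Fin n ⊕ Fin n) : squareRel x i j ∈ S := by
  rcases i with i | i <;> rcases j with j | j <;>
    simp only [squareRel, fromBlocks_apply₁₁, fromBlocks_apply₁₂, fromBlocks_apply₂₁,
      fromBlocks_apply₂₂, one_apply_mem h1, Matrix.zero_apply, Matrix.neg_apply, neg_mem_iff,
      zero_mem, diagonal_apply]
  split_ifs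
  exacts [hx i, S.zero_mem]

theorem pairRel_mem {S : AddSubgroup R} (h1 : 1 ∈ S) (hx : ∀ i, x i ∈ S)
    (i j : Fin n ⊕ BlockPair n) : pairRel x i j ∈ S := by
  rcases i with i | i <;> rcases j with j | j <;>
    simp only [pairRel, fromBlocks_apply₁₁, fromBlocks_apply₁₂, fromBlocks_apply₂₁,
      fromBlocks_apply₂₂, one_apply_mem h1, Matrix.zero_apply, zero_mem, of_apply]
  split_ifs
  exacts [S.neg_mem (hx _), S.zero_mem]

theorem squareRel_mul : squareRel x * replicateCol Unit (squareFamily x) =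
    replicateCol Unit (Sum.elim x 0) := by
  ext (i | i) j <;>
    simp [squareRel, squareFamily, mul_apply, diagonal_apply, one_apply]

theorem mul_pairRel : replicateRow Unit (pairFamily x) * pairRel x =
    replicateRow Unit (Sum.elim x 0) := by
  ext j (i | i) <;>
    simp [pairRel, pairFamily, mul_apply, one_apply]

/-- Membership in the product of the two monomial families and of `{1, x₁, …, xₙ}`. -/
def Factors (f : R) : Prop :=
  ∃ (a : Unit ⊕ (Fin n ⊕ BlockPair n)) (l : Option (Fin n)) (b : Unit ⊕ (Fin n ⊕ Fin n)),
    Sum.elim (fun _ => 1) (pairFamily x) a * l.elim 1 x * Sum.elim (fun _ => 1) (squareFamily x) b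
      = f

variable {x}

theorem factors_of_mod_eq {a b : Fin n} (hab : a.1 % 3 = b.1 % 3) (c d : Fin n) :
    Factors x (x a * x b * x c * x d) := by
  have key : ∀ {a b : Fin n}, a < b → a.1 % 3 = b.1 % 3 →
      Factors x (x a * x b * x c * x d) := fun h h' => by
    obtain ⟨s, rfl, rfl⟩ := BlockPair.exists_of_lt h h'
    exact ⟨.inr (.inr s), some c, .inr (.inl d), rfl⟩
  rcases lt_trichotomy a b with h | rfl | h
  · exact key h hab
  · exact ⟨.inr (.inl c), some d, .inr (.inr a), by simp [pairFamily, squareFamily]; ring⟩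
  · rw [mul_comm (x a)]
    exact key h hab.symm

theorem factors_four (a b c d : Fin n) : Factors x (x a * x b * x c * x d) := by
  have h : a.1 % 3 = b.1 % 3 ∨ a.1 % 3 = c.1 % 3 ∨ a.1 % 3 = d.1 % 3 ∨
      b.1 % 3 = c.1 % 3 ∨ b.1 % 3 = d.1 % 3 ∨ c.1 % 3 = d.1 % 3 := by omega
  rcases h with h | h | h | h | h | h
  · exact factors_of_mod_eq h c d
  · convert factors_of_mod_eq h b d using 1; ring
  · convert factors_of_mod_eq h b c using 1; ring
  · convert factors_of_mod_eq h a d using 1; ring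
  · convert factors_of_mod_eq h a c using 1; ring
  · convert factors_of_mod_eq h a b using 1; ring

theorem factors_multiset_prod (s : Multiset (Fin n)) (hs : s.card ≤ 4) :
    Factors x (s.map x).prod := by
  obtain h | h | h | h | h : s.card = 0 ∨ s.card = 1 ∨ s.card = 2 ∨ s.card = 3 ∨ s.card = 4 := by
    omega
  · rw [Multiset.card_eq_zero] at h
    exact ⟨.inl (), none, .inl (), by simp [h]⟩
  · obtain ⟨a, rfl⟩ := Multiset.card_eq_one.mp h
    exact ⟨.inl (), some a, .inl (), by simp⟩
  · obtain ⟨a, b, rfl⟩ := Multiset.card_eq_two.mp h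
    exact ⟨.inl (), some a, .inr (.inl b), by simp [squareFamily]⟩
  · obtain ⟨a, b, c, rfl⟩ := Multiset.card_eq_three.mp h
    exact ⟨.inr (.inl a), some b, .inr (.inl c), by simp [squareFamily, pairFamily, mul_assoc]⟩
  · obtain ⟨a, ha⟩ := Multiset.card_pos_iff_exists_mem.mp (by omega : 0 < s.card)
    obtain ⟨t, rfl⟩ := Multiset.exists_cons_of_mem ha
    obtain ⟨b, c, d, rfl⟩ := Multiset.card_eq_three.mp (by simpa using h : t.card = 3)
    simpa [mul_assoc] using factors_four (x := x) a b c d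

theorem factors_prod_pow (α : ExpLE n 4) : Factors x (∏ i, x i ^ α.1 i) := by
  have h := factors_multiset_prod (x := x) (Finsupp.toMultiset α.1)
    (by rw [Finsupp.card_toMultiset]; exact α.2)
  rwa [Finsupp.toMultiset_map, Finsupp.prod_toMultiset,
    Finsupp.prod_mapDomain_index (by simp) (by simp [pow_add]),
    Finsupp.prod_fintype _ _ (by simp)] at h

end Factorization

theorem exists_isUDR_four (K : Type*) [Field K] (n : ℕ) :
    ∃ M : Matrix (Fin (3 * n + 1 + Fintype.card (BlockPair n)))
      (Fin (3 * n + 1 + Fintype.card (BlockPair n))) (URing K n 4),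
      IsUDR K n 4 (3 * n + 1 + Fintype.card (BlockPair n)) M := by
  classical
  set x : Fin n → URing K n 4 := fun i => X (Sum.inl i) with hx
  choose a l b hab using fun α : ExpLE n 4 => factors_prod_pow (x := x) α
  set L : Matrix (Unit ⊕ (Fin n ⊕ BlockPair n)) (Unit ⊕ (Fin n ⊕ Fin n)) (URing K n 4) :=
    of fun i j => ∑ α, if a α = i ∧ b α = j then X (Sum.inr α) * (l α).elim 1 x else 0 with hL
  set S := (Submodule.span K (allowedMonomials K n 4)).toAddSubgroup
  have h1 : (1 : URing K n 4) ∈ S := Submodule.subset_span (by simp [allowedMonomials])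
  have hX : ∀ i, x i ∈ S := fun i => Submodule.subset_span (by simp [allowedMonomials, hx])
  have hLS : ∀ i j, L i j ∈ S := fun i j => S.sum_mem fun α _ => by
    split_ifs
    · refine Submodule.subset_span ?_
      cases l α <;> simp [allowedMonomials, hx]
    · exact S.zero_mem
  have hdet := det_bordered L (pairFamily x) (pairRel x) (squareFamily x) (squareRel x)
    (det_pairRel x) (det_squareRel x)
  rw [squareRel_mul, mul_pairRel] at hdet
  have hsum : ∑ i, ∑ j, Sum.elim (fun _ => 1) (pairFamily x) i * L i j *
      Sum.elim (fun _ => 1) (squareFamily x) j = genPoly K n 4 := by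
    simp only [hL, of_apply, Finset.mul_sum, Finset.sum_mul]
    rw [Finset.sum_congr rfl fun i _ => Finset.sum_comm, Finset.sum_comm]
    refine Finset.sum_congr rfl fun α _ => ?_
    rw [Finset.sum_eq_single (a α), Finset.sum_eq_single (b α)]
    · rw [← hab α, if_pos ⟨rfl, rfl⟩]
      ring
    · intro j _ hj
      simp [hj.symm]
    · simp
    · intro i _ hi
      simp [hi.symm]
    · simp
  have hcard : Fintype.card ((Unit ⊕ (Fin n ⊕ BlockPair n)) ⊕ (Fin n ⊕ Fin n)) =
      3 * n + 1 + Fintype.card (BlockPair n) := by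
    simp only [Fintype.card_sum, Fintype.card_fin, Fintype.card_unit]
    ring
  refine ⟨reindex (Fintype.equivFinOfCardEq hcard) (Fintype.equivFinOfCardEq hcard) _, ?_,
    (det_reindex_self _ _).trans (hdet.trans hsum)⟩
  intro i j
  refine bordered_mem S hLS ?_ (pairRel_mem x h1 hX) ?_ (squareRel_mem x h1 hX) _ _
  · rintro _ (i | i) <;> simp [hX, S.zero_mem]
  · rintro (i | i) _ <;> simp [hX, S.zero_mem]

end UniformDet

/-- Example 6.3, Turán-system construction. With `m = ⌊n/3⌋`,
`N*(n,4) ≤ 3n + 1 + m·n − 3m(m+1)/2`. -/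
theorem Nstar_degree_four (K : Type*) [Field K] (n : ℕ) (hn : 1 ≤ n) :
    Nstar K n 4 ≤ 3 * n + 1 + (n / 3) * n - 3 * ((n / 3) * (n / 3 + 1)) / 2 := by
  refine Nat.sInf_le ?_
  obtain ⟨M, hM⟩ := UniformDet.exists_isUDR_four K n
  have hcard := UniformDet.card_blockPair n
  have h := UniformDet.two_mul_sum_div_three n
  have hN : 3 * n + 1 + Fintype.card (UniformDet.BlockPair n) =
      3 * n + 1 + (n / 3) * n - 3 * ((n / 3) * (n / 3 + 1)) / 2 := by
    omega
  exact hN ▸ ⟨M, hM⟩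
end

section
/- Let K be a field, n ≥ 1, d ≥ 0, and let M = M₀ + Σ_{|α|≤d} c_α M_α be a uniform determinantal representation of p_{n,d} of size N, where M₀ and each M_α are N×N matrices whose entries are affine-linear forms in x_1,…,x_n. Suppose there exist N×N matrices Q and Z with entries in K[x_1,…,x_n] such that det(Q) = det(Z) = 1 and QMZ is a triangular matrix (all entries on one side of the diagonal are zero) with exactly one diagonal entry equal to p_{n,d} and all other diagonal entries equal to 1. Then for every k ≥ 1 and every choice of matrices C_α ∈ K^{k×k} (|α| ≤ d), the Nk×Nk matrix M̃ := M₀ ⊗ I_k + Σ_{|α|≤d} M_α ⊗ C_α over K[x_1,…,x_n] satisfies det(M̃) = det(P_{n,d}), where P_{n,d} := Σ_{|α|≤d} x^α C_α is the corresponding k×k matrix polynomial and ⊗ denotes the Kronecker product of matrices. -/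
open MvPolynomial

/-- A block triangular matrix indexed by a product, with blocks given by the first factor, has as
determinant the product of the determinants of its diagonal blocks. -/
theorem Matrix.BlockTriangular.det_prod_fst {ι m R : Type*} [CommRing R] [Fintype ι]
    [LinearOrder ι] [Fintype m] [DecidableEq m] {A : Matrix (ι × m) (ι × m) R}
    (h : A.BlockTriangular Prod.fst) :
    A.det = ∏ i, (A.submatrix (Prod.mk i) (Prod.mk i)).det := by
  rw [h.det_fintype]
  refine Finset.prod_congr rfl fun i _ => ?_
  let e : m ≃ {p : ι × m // p.1 = i} :=
    { toFun := fun a => ⟨(i, a), rfl⟩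
      invFun := fun p => p.1.2
      left_inv := fun _ => rfl
      right_inv := fun ⟨⟨_, _⟩, hp⟩ => by cases hp; rfl }
  rw [← Matrix.det_submatrix_equiv_self e]
  rfl

section AffineInParameters

variable {R σ τ : Type*} [CommRing R] [Fintype τ]

/-- The polynomial `f + Σ_t c_t g_t`, affine-linear in the parameters `c_t`. -/
noncomputable def affineInParameters (f : MvPolynomial σ R) (g : τ → MvPolynomial σ R) :
    MvPolynomial (σ ⊕ τ) R :=
  rename Sum.inl f + ∑ t, X (Sum.inr t) * rename Sum.inl (g t)

theorem aeval_affineInParameters (c : τ → MvPolynomial σ R) (f : MvPolynomial σ R)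
    (g : τ → MvPolynomial σ R) :
    aeval (Sum.elim X c) (affineInParameters f g) = f + ∑ t, c t * g t := by
  simp only [affineInParameters, map_add, map_sum, map_mul, aeval_X, aeval_rename,
    Sum.elim_comp_inl, Sum.elim_inr, aeval_X_left_apply]

theorem affineInParameters_inj [DecidableEq τ] {f f' : MvPolynomial σ R}
    {g g' : τ → MvPolynomial σ R} :
    affineInParameters f g = affineInParameters f' g' ↔ f = f' ∧ g = g' := by
  refine ⟨fun h => ?_, fun ⟨hf, hg⟩ => hf ▸ hg ▸ rfl⟩
  have key (c : τ → MvPolynomial σ R) : f + ∑ t, c t * g t = f' + ∑ t, c t * g' t := by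
    simp only [← aeval_affineInParameters, h]
  have hf : f = f' := by simpa using key 0
  refine ⟨hf, funext fun t => ?_⟩
  simpa [hf, Pi.single_apply] using key (Pi.single t 1)

theorem rename_inl_eq_affineInParameters (f : MvPolynomial σ R) :
    rename Sum.inl f = affineInParameters f (0 : τ → MvPolynomial σ R) := by
  simp [affineInParameters]

theorem genPoly_eq_affineInParameters (K : Type*) [Field K] (n d : ℕ) :
    genPoly K n d = affineInParameters 0 fun α : ExpLE n d => ∏ i, X i ^ α.1 i := by
  simp [genPoly, affineInParameters]

/-- Multiplying a matrix that is affine-linear in the parameters on both sides by parameter-free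
matrices multiplies each of its coefficient matrices. -/
theorem mul_affineInParameters_mul {ι : Type*} [Fintype ι] (Q Z A : Matrix ι ι (MvPolynomial σ R))
    (B : τ → Matrix ι ι (MvPolynomial σ R)) :
    Q.map (rename Sum.inl) * Matrix.of (fun i j => affineInParameters (A i j) fun t => B t i j) *
        Z.map (rename Sum.inl) =
      Matrix.of fun i j => affineInParameters ((Q * A * Z) i j) fun t => (Q * B t * Z) i j := by
  have key (A : Matrix ι ι (MvPolynomial σ R)) (B : τ → Matrix ι ι (MvPolynomial σ R)) :
      (Matrix.of fun i j => affineInParameters (A i j) fun t => B t i j) =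
        A.map (rename Sum.inl) +
          ∑ t, (X (Sum.inr t) : MvPolynomial (σ ⊕ τ) R) • (B t).map (rename Sum.inl) := by
    ext1 i j
    simp [affineInParameters, Matrix.sum_apply]
  rw [key, key (Q * A * Z) fun t => Q * B t * Z]
  simp only [Matrix.map_mul, mul_add, add_mul, Matrix.mul_sum, Matrix.sum_mul, Matrix.mul_smul,
    Matrix.smul_mul]

end AffineInParameters

section KroneckerSubstitution

variable {S ι m τ : Type*} [CommRing S] [Fintype τ] [DecidableEq m]

/-- The matrix `A ⊗ 1 + Σ_t B_t ⊗ D_t`, obtained from `A + Σ_t c_t B_t` by substituting the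
matrices `D_t` for the parameters `c_t`. -/
def kroneckerSubst (D : τ → Matrix m m S) (A : Matrix ι ι S) (B : τ → Matrix ι ι S) :
    Matrix (ι × m) (ι × m) S :=
  Matrix.kroneckerMap (· * ·) A 1 + ∑ t, Matrix.kroneckerMap (· * ·) (B t) (D t)

theorem kroneckerSubst_submatrix (D : τ → Matrix m m S) (A : Matrix ι ι S)
    (B : τ → Matrix ι ι S) (i j : ι) :
    (kroneckerSubst D A B).submatrix (Prod.mk i) (Prod.mk j) =
      A i j • 1 + ∑ t, B t i j • D t := by
  ext p q
  simp [kroneckerSubst, Matrix.sum_apply]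

theorem kroneckerSubst_apply_eq_zero (D : τ → Matrix m m S) {A : Matrix ι ι S}
    {B : τ → Matrix ι ι S} {p q : ι × m} (hA : A p.1 q.1 = 0) (hB : ∀ t, B t p.1 q.1 = 0) :
    kroneckerSubst D A B p q = 0 := by
  simp [kroneckerSubst, Matrix.sum_apply, hA, hB]

theorem det_kroneckerSubst_mul [Fintype ι] [DecidableEq ι] [Fintype m] (D : τ → Matrix m m S)
    (Q Z A : Matrix ι ι S) (B : τ → Matrix ι ι S) (hQ : Q.det = 1) (hZ : Z.det = 1) :
    (kroneckerSubst D (Q * A * Z) fun t => Q * B t * Z).det = (kroneckerSubst D A B).det := by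
  have key (A : Matrix ι ι S) (E : Matrix m m S) :
      Matrix.kroneckerMap (· * ·) (Q * A * Z) E =
        Matrix.kroneckerMap (· * ·) Q 1 * Matrix.kroneckerMap (· * ·) A E *
          Matrix.kroneckerMap (· * ·) Z 1 := by
    rw [← Matrix.mul_kronecker_mul, ← Matrix.mul_kronecker_mul, one_mul, mul_one]
  simp only [kroneckerSubst, key, ← Matrix.mul_sum, ← Matrix.sum_mul, ← mul_add, ← add_mul]
  rw [Matrix.det_mul, Matrix.det_mul, Matrix.det_kronecker, Matrix.det_kronecker, hQ, hZ]
  simp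

/-- If all `A` and `B_t` are upper triangular or all are lower triangular, the determinant of
`A ⊗ 1 + Σ_t B_t ⊗ D_t` is the product of the determinants of the diagonal blocks. -/
theorem det_kroneckerSubst_of_triangular [Fintype ι] [LinearOrder ι] [Fintype m]
    (D : τ → Matrix m m S) {A : Matrix ι ι S} {B : τ → Matrix ι ι S}
    (h : (∀ i j, j < i → A i j = 0 ∧ ∀ t, B t i j = 0) ∨
      ∀ i j, i < j → A i j = 0 ∧ ∀ t, B t i j = 0) :
    (kroneckerSubst D A B).det = ∏ i, (A i i • (1 : Matrix m m S) + ∑ t, B t i i • D t).det := by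
  simp only [← kroneckerSubst_submatrix]
  rcases h with h | h
  · exact Matrix.BlockTriangular.det_prod_fst fun p q hpq =>
      kroneckerSubst_apply_eq_zero D (h _ _ hpq).1 (h _ _ hpq).2
  · have hT : (kroneckerSubst D A B).transpose.BlockTriangular Prod.fst := fun p q hpq =>
      kroneckerSubst_apply_eq_zero D (h _ _ hpq).1 (h _ _ hpq).2
    rw [← Matrix.det_transpose, hT.det_prod_fst]
    exact Finset.prod_congr rfl fun i _ => by
      rw [← Matrix.transpose_submatrix, Matrix.det_transpose]

end KroneckerSubstitution

/-- Theorem 7.1. Let `M = M₀ + Σ_{|α|≤d} c_α M_α` be a uniform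
determinantal representation of `p_{n,d}` of size `N`, with `M₀` and the `M_α` matrices over
`K[x₁,…,xₙ]`. Suppose there are matrices `Q`, `Z` over `K[x₁,…,xₙ]` with
`det Q = det Z = 1` such that `Q M Z` is triangular with one diagonal entry equal to
`p_{n,d}` and all other diagonal entries equal to `1`. Then for every `k ≥ 1` and all
coefficient matrices `C_α ∈ K^{k×k}`, the matrix
`M̃ = M₀ ⊗ I_k + Σ_α M_α ⊗ C_α` satisfies `det M̃ = det P_{n,d}`, where
`P_{n,d} = Σ_{|α|≤d} x^α C_α` is the corresponding matrix polynomial. -/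
theorem udr_matrix_polynomial (K : Type*) [Field K] (n d N : ℕ)
    (M₀ : Matrix (Fin N) (Fin N) (MvPolynomial (Fin n) K))
    (Mc : ExpLE n d → Matrix (Fin N) (Fin N) (MvPolynomial (Fin n) K))
    (M : Matrix (Fin N) (Fin N) (URing K n d))
    (hMdecomp : M = Matrix.of fun i j =>
      rename Sum.inl (M₀ i j) +
        ∑ α : ExpLE n d, X (Sum.inr α) * rename Sum.inl (Mc α i j))
    (hM : IsUDR K n d N M)
    (Q Z : Matrix (Fin N) (Fin N) (MvPolynomial (Fin n) K))
    (hQ : Q.det = 1) (hZ : Z.det = 1)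
    (T : Matrix (Fin N) (Fin N) (URing K n d))
    (hT : T = (Q.map ⇑(rename (Sum.inl : Fin n → Fin n ⊕ ExpLE n d))) * M *
      (Z.map ⇑(rename (Sum.inl : Fin n → Fin n ⊕ ExpLE n d))))
    (htri : T.BlockTriangular (id : Fin N → Fin N) ∨
      (Matrix.transpose T).BlockTriangular (id : Fin N → Fin N))
    (i₀ : Fin N) (hdiag₀ : T i₀ i₀ = genPoly K n d)
    (hdiag₁ : ∀ i : Fin N, i ≠ i₀ → T i i = 1) :
    ∀ (k : ℕ), 1 ≤ k → ∀ Cm : ExpLE n d → Matrix (Fin k) (Fin k) K,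
      (Matrix.kroneckerMap (· * ·) M₀
          (1 : Matrix (Fin k) (Fin k) (MvPolynomial (Fin n) K)) +
        ∑ α : ExpLE n d,
          Matrix.kroneckerMap (· * ·) (Mc α) ((Cm α).map MvPolynomial.C)).det
      = (∑ α : ExpLE n d,
          (∏ i : Fin n, (X i : MvPolynomial (Fin n) K) ^ (α.1 i)) •
            ((Cm α).map MvPolynomial.C)).det := by
  intro k _ Cm
  have hTentry (i j : Fin N) : T i j =
      affineInParameters ((Q * M₀ * Z) i j) fun α => (Q * Mc α * Z) i j := by
    rw [hT, hMdecomp]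
    exact congrFun₂ (mul_affineInParameters_mul Q Z M₀ Mc) i j
  have hzero {i j : Fin N} (h : T i j = 0) :
      (Q * M₀ * Z) i j = 0 ∧ ∀ α, (Q * Mc α * Z) i j = 0 := by
    rw [hTentry, ← map_zero (rename Sum.inl), rename_inl_eq_affineInParameters,
      affineInParameters_inj] at h
    exact ⟨h.1, congrFun h.2⟩
  let D (α : ExpLE n d) : Matrix (Fin k) (Fin k) (MvPolynomial (Fin n) K) := (Cm α).map C
  change (kroneckerSubst D M₀ Mc).det = _
  rw [← det_kroneckerSubst_mul D Q Z M₀ Mc hQ hZ,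
    det_kroneckerSubst_of_triangular D
      (htri.imp (fun h i j hij => hzero (h hij)) fun h i j hij => hzero (h hij)),
    Finset.prod_eq_single i₀]
  · rw [hTentry, genPoly_eq_affineInParameters, affineInParameters_inj] at hdiag₀
    simp only [hdiag₀.1, zero_smul, zero_add, congrFun hdiag₀.2, D]
  · intro i _ hi
    have h := hdiag₁ i hi
    rw [hTentry, ← map_one (rename Sum.inl), rename_inl_eq_affineInParameters,
      affineInParameters_inj] at h
    simp [h.1, congrFun h.2]
  · simp
end
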